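/- arXiv:math/9911195 — 2 statements merged into one kernel-verified Lean document; each statement's English description precedes it below -/
import Mathlib

section
/- Let N be a Niemeier lattice with set of roots R = {r ∈ N : B(r, r) = 2}. Then for every y ∈ N, 12·∑_{r ∈ R} B(y, r)² = |R|·B(y, y); equivalently, ∑_{r ∈ R} B(y, r)² = 2h·B(y, y) where h = |R|/24 is the Coxeter number of N. -/
open Complex Real in
lemma theta_char_hasSum (k : ℤ) {a : ℕ} (ha : 0 < a) {τ : ℂ} (hτ : 0 < τ.im) :
    HasSum (fun n : ℤ ↦ cexp (2 * π * I * (n * k / a)) * cexp (π * I * τ * (n ^ 2 / a)))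
      (jacobiTheta₂ (k / a) (τ / a)) := by
  have hτ' : 0 < (τ / a).im := by
    rw [Complex.div_natCast_im]; positivity
  refine (hasSum_jacobiTheta₂_term (k / a) hτ').congr_fun fun n ↦ ?_
  rw [jacobiTheta₂_term, ← Complex.exp_add]
  congr 1; ring

open Complex Real in
lemma theta_char_hasDerivAt (k : ℤ) {a : ℕ} (ha : 0 < a) {τ : ℂ} (hτ : 0 < τ.im) :
    ∃ d : ℂ, HasDerivAt (fun τ : ℂ ↦ jacobiTheta₂ (k / a) (τ / a)) (π * I * d) τ ∧
    HasSum (fun n : ℤ ↦ cexp (2 * π * I * (n * k / a)) *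
      (n ^ 2 / a * cexp (π * I * τ * (n ^ 2 / a)))) d := by
  have hτ' : 0 < (τ / a).im := by
    rw [Complex.div_natCast_im]; positivity
  have hpath : HasDerivAt (fun τ : ℂ ↦ ((k / a : ℂ), τ / (a : ℂ))) (0, 1 / (a : ℂ)) τ :=
    (hasDerivAt_const τ _).prodMk ((hasDerivAt_id τ).div_const _)
  have h1 := (hasFDerivAt_jacobiTheta₂ (k / a) hτ').comp_hasDerivAt
    (f := fun τ : ℂ ↦ ((k / a : ℂ), τ / (a : ℂ))) τ hpath
  have hpi : (π * I : ℂ) ≠ 0 := by simp [Real.pi_ne_zero]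
  refine ⟨(π * I)⁻¹ * jacobiTheta₂_fderiv (k / a) (τ / a) (0, 1 / a), ?_, ?_⟩
  · rw [mul_inv_cancel_left₀ hpi]; exact h1
  · have h2 := ((hasSum_jacobiTheta₂_term_fderiv (k / a) hτ').mapL
      (ContinuousLinearMap.apply ℂ ℂ ((0, 1 / a) : ℂ × ℂ))).mul_left (π * I)⁻¹
    refine h2.congr_fun fun n ↦ ?_
    simp only [jacobiTheta₂_term_fderiv, ContinuousLinearMap.apply_apply,
      smul_apply, add_apply, ContinuousLinearMap.coe_fst',
      ContinuousLinearMap.coe_snd', smul_eq_mul]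
    rw [mul_left_comm, ← Complex.exp_add]
    field_simp
    ring_nf

open Complex Real in
lemma theta_coset_hasSum (k : ℤ) {a : ℕ} (ha : 0 < a) {σ : ℂ} (hσ : 0 < σ.im) :
    HasSum (fun n : ℤ ↦ cexp (π * I * σ * ((k + a * n) ^ 2 / a)))
      (cexp (π * I * σ * (k ^ 2 / a)) * jacobiTheta₂ (k * σ) (a * σ)) := by
  have ha' : (a : ℂ) ≠ 0 := by exact_mod_cast ha.ne'
  have hσ' : 0 < (a * σ).im := by
    simp only [mul_im, natCast_re, natCast_im, zero_mul, add_zero]; positivity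
  refine ((hasSum_jacobiTheta₂_term (k * σ) hσ').mul_left _).congr_fun fun n ↦ ?_
  rw [jacobiTheta₂_term, ← Complex.exp_add]
  congr 1; field_simp; ring

open Complex Real in
lemma theta_coset_hasDerivAt (k : ℤ) {a : ℕ} (ha : 0 < a) {σ : ℂ} (hσ : 0 < σ.im) :
    ∃ d : ℂ, HasDerivAt
      (fun σ : ℂ ↦ cexp (π * I * σ * (k ^ 2 / a)) * jacobiTheta₂ (k * σ) (a * σ)) (π * I * d) σ ∧
    HasSum (fun n : ℤ ↦ (k + a * n) ^ 2 / a * cexp (π * I * σ * ((k + a * n) ^ 2 / a))) d := by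
  have ha' : (a : ℂ) ≠ 0 := by exact_mod_cast ha.ne'
  have hσ' : 0 < (a * σ).im := by
    simp only [mul_im, natCast_re, natCast_im, zero_mul, add_zero]; positivity
  have hpath : HasDerivAt (fun σ : ℂ ↦ ((k * σ : ℂ), (a * σ : ℂ))) ((k : ℂ), (a : ℂ)) σ := by
    simpa using ((hasDerivAt_id σ).const_mul (k : ℂ)).prodMk ((hasDerivAt_id σ).const_mul (a : ℂ))
  have h1 := (hasFDerivAt_jacobiTheta₂ (k * σ) hσ').comp_hasDerivAt
    (f := fun σ : ℂ ↦ ((k * σ : ℂ), (a * σ : ℂ))) σ hpath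
  have hpi : (π * I : ℂ) ≠ 0 := by simp [Real.pi_ne_zero]
  have he : HasDerivAt (fun σ : ℂ ↦ cexp (π * I * σ * (k ^ 2 / a)))
      (cexp (π * I * σ * (k ^ 2 / a)) * (π * I * (k ^ 2 / a))) σ := by
    have := (((hasDerivAt_id σ).const_mul (π * I : ℂ)).mul_const (k ^ 2 / a : ℂ)).cexp
    simpa using this
  have h2 := he.mul h1
  refine ⟨_, (h2.congr_deriv (mul_inv_cancel_left₀ hpi _).symm), ?_⟩
  have h3 := (((hasSum_jacobiTheta₂_term (k * σ) hσ').mul_left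
    (cexp (π * I * σ * (k ^ 2 / a)) * (π * I * (k ^ 2 / a)))).add
    (((hasSum_jacobiTheta₂_term_fderiv (k * σ) hσ').mapL
      (ContinuousLinearMap.apply ℂ ℂ ((k, a) : ℂ × ℂ))).mul_left
        (cexp (π * I * σ * (k ^ 2 / a))))).mul_left (π * I)⁻¹
  refine h3.congr_fun fun n ↦ ?_
  simp only [jacobiTheta₂_term_fderiv, ContinuousLinearMap.apply_apply, jacobiTheta₂_term,
      smul_apply, add_apply, ContinuousLinearMap.coe_fst',
      ContinuousLinearMap.coe_snd', smul_eq_mul]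
  have : cexp (π * I * σ * ((k + a * n) ^ 2 / a)) = cexp (π * I * σ * (k ^ 2 / a)) *
      cexp (2 * ↑π * I * ↑n * (↑k * σ) + ↑π * I * ↑n ^ 2 * (↑a * σ)) := by
    rw [← Complex.exp_add]
    congr 1; field_simp; ring
  rw [this]
  field_simp
  ring

open Complex Real in
lemma theta_functional (k : ℤ) {a : ℕ} (ha : 0 < a) {τ : ℂ} (hτ : 0 < τ.im) :
    jacobiTheta₂ (k / a) (τ / a) = ((√(a : ℝ) : ℝ) : ℂ) * (-I * τ) ^ (-(1 / 2) : ℂ) *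
      (cexp (π * I * (-1 / τ) * (k ^ 2 / a)) * jacobiTheta₂ (k * (-1 / τ)) (a * (-1 / τ))) := by
  have hτ0 : τ ≠ 0 := by rintro rfl; simp at hτ
  have ha' : (a : ℂ) ≠ 0 := by exact_mod_cast ha.ne'
  have hx : -I * τ ≠ 0 := by simp [hτ0]
  have hpow : 1 / (-I * (τ / a)) ^ (1 / 2 : ℂ) =
      ((√(a : ℝ) : ℝ) : ℂ) * (-I * τ) ^ (-(1 / 2) : ℂ) := by
    rw [show -I * (τ / a) = (((a : ℝ)⁻¹ : ℝ) : ℂ) * (-I * τ) by push_cast; ring]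
    have hr : (0 : ℝ) < (a : ℝ)⁻¹ := by positivity
    have hs : ((√(a : ℝ) : ℝ) : ℂ) = cexp (Real.log a * (1 / 2)) := by
      rw [Real.sqrt_eq_rpow, Complex.ofReal_cpow (by positivity),
        Complex.cpow_def_of_ne_zero (by exact_mod_cast ha.ne'), Complex.ofReal_log (by positivity)]
      norm_num
    rw [hs, Complex.cpow_def_of_ne_zero (mul_ne_zero (by exact_mod_cast hr.ne') hx),
      Complex.cpow_def_of_ne_zero hx, Complex.log_ofReal_mul hr hx, one_div, ← Complex.exp_neg,
      ← Complex.exp_add, Real.log_inv]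
    congr 1; push_cast; ring
  rw [jacobiTheta₂_functional_equation, hpow, ← jacobiTheta₂_neg_left (k / a / (τ / a)), mul_assoc]
  congr 2
  · congr 1; field_simp
  · congr 1 <;> field_simp

open Complex Real in
lemma theta_char_coset_transform (k : ℤ) {a : ℕ} (ha : 0 < a) {τ : ℂ} (hτ : 0 < τ.im) :
    ∃ U V : ℂ,
      HasSum (fun n : ℤ ↦ cexp (π * I * (-1 / τ) * ((k + a * n) ^ 2 / a))) U ∧
      HasSum (fun n : ℤ ↦ (k + a * n) ^ 2 / a *
        cexp (π * I * (-1 / τ) * ((k + a * n) ^ 2 / a))) V ∧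
      HasSum (fun n : ℤ ↦ cexp (2 * π * I * (n * k / a)) * cexp (π * I * τ * (n ^ 2 / a)))
        (((√(a : ℝ) : ℝ) : ℂ) * (-I * τ) ^ (-(1 / 2) : ℂ) * U) ∧
      HasSum (fun n : ℤ ↦ cexp (2 * π * I * (n * k / a)) *
          (n ^ 2 / a * cexp (π * I * τ * (n ^ 2 / a))))
        (((√(a : ℝ) : ℝ) : ℂ) * (-I * τ) ^ (-(1 / 2) : ℂ) *
          ((τ ^ 2)⁻¹ * V - (2 * π * I * τ)⁻¹ * U)) := by
  have hτ0 : τ ≠ 0 := by rintro rfl; simp at hτ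
  have hσ : 0 < (-1 / τ).im := by
    rw [neg_div, one_div, Complex.neg_im, Complex.inv_im, neg_div, neg_neg]
    have := Complex.normSq_pos.mpr hτ0
    positivity
  have hpi : (π * I : ℂ) ≠ 0 := by simp [Real.pi_ne_zero]
  obtain ⟨V, hV, hVs⟩ := theta_coset_hasDerivAt k ha hσ
  obtain ⟨t, ht, hts⟩ := theta_char_hasDerivAt k ha hτ
  refine ⟨_, V, theta_coset_hasSum k ha hσ, hVs,
    (theta_functional k ha hτ) ▸ theta_char_hasSum k ha hτ, ?_⟩
  convert hts using 1
  have hx : -I * τ ∈ slitPlane := by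
    left; simpa using hτ
  have hx0 : -I * τ ≠ 0 := slitPlane_ne_zero hx
  have hg : HasDerivAt (fun τ : ℂ ↦ ((√(a : ℝ) : ℝ) : ℂ) * (-I * τ) ^ (-(1 / 2) : ℂ))
      (((√(a : ℝ) : ℝ) : ℂ) * (-I * τ) ^ (-(1 / 2) : ℂ) * (-(2 * τ)⁻¹)) τ := by
    have := (((hasDerivAt_id τ).const_mul (-I)).cpow_const (c := -(1 / 2)) hx).const_mul
      ((√(a : ℝ) : ℝ) : ℂ)
    refine this.congr_deriv ?_
    simp only [id, mul_one]
    rw [Complex.cpow_sub _ _ hx0, Complex.cpow_one]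
    field_simp
  have hinv : HasDerivAt (fun τ : ℂ ↦ -1 / τ) ((τ ^ 2)⁻¹) τ := by
    have := (hasDerivAt_inv hτ0).const_mul (-1 : ℂ)
    simpa only [div_eq_mul_inv, neg_mul, one_mul, neg_neg, neg_div] using this
  have h1 := hg.mul (HasDerivAt.comp τ (h₂ := fun σ : ℂ ↦ cexp (π * I * σ * (k ^ 2 / a)) *
    jacobiTheta₂ (k * σ) (a * σ)) hV hinv)
  have h3 := ht.unique (h1.congr_of_eventuallyEq (by
    filter_upwards [(continuous_im.isOpen_preimage _ isOpen_Ioi).mem_nhds hτ] with z hz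
    exact theta_functional k ha hz))
  apply mul_left_cancel₀ hpi
  rw [h3]
  simp only [Function.comp]
  field_simp
  ring

lemma hasSum_fin_pi_prod {d : ℕ} {F : Fin d → ℤ → ℂ} {s : Fin d → ℂ}
    (hF : ∀ i, HasSum (F i) (s i)) :
    HasSum (fun m : Fin d → ℤ ↦ ∏ i, F i (m i)) (∏ i, s i) := by
  induction d with
  | zero => simp
  | succ d ih =>
    have h := ih fun i ↦ hF i.succ
    have h0 := hF 0
    have hs : Summable fun p : ℤ × (Fin d → ℤ) ↦ F 0 p.1 * ∏ i, F (Fin.succ i) (p.2 i) :=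
      summable_mul_of_summable_norm (f := F 0) (g := fun m : Fin d → ℤ ↦ ∏ i, F (Fin.succ i) (m i))
        h0.summable.norm h.summable.norm
    have hmul := h0.mul h hs
    rw [Fin.prod_univ_succ, ← (Fin.consEquiv fun _ : Fin (d + 1) ↦ ℤ).hasSum_iff]
    refine hmul.congr_fun fun p ↦ ?_
    simp [Fin.prod_univ_succ, Fin.consEquiv]

/-- The elements of `M` whose coordinates are reduced modulo `a`. -/
noncomputable def reducedReps {d : ℕ} (a : Fin d → ℕ) (M : AddSubgroup (Fin d → ℤ)) :
    Finset (Fin d → ℤ) :=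
  open Classical in (Fintype.piFinset fun l ↦ Finset.Ico 0 (a l : ℤ)).filter (· ∈ M)

section reducedReps

variable {d : ℕ} {a : Fin d → ℕ} {M : AddSubgroup (Fin d → ℤ)}

lemma mem_reducedReps {k : Fin d → ℤ} :
    k ∈ reducedReps a M ↔ (∀ l, 0 ≤ k l ∧ k l < a l) ∧ k ∈ M := by
  simp [reducedReps]

lemma emod_mem_iff (haM : ∀ n : Fin d → ℤ, (fun l ↦ a l * n l) ∈ M) {m : Fin d → ℤ} :
    (fun l ↦ m l % a l) ∈ M ↔ m ∈ M := by
  have h : m = (fun l ↦ m l % a l) + fun l ↦ a l * (m l / a l) := by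
    ext l; simp [Int.emod_add_mul_ediv]
  conv_rhs => rw [h]
  exact (M.add_mem_cancel_right (haM _)).symm

lemma emod_mem_reducedReps (ha : ∀ l, 0 < a l) (haM : ∀ n : Fin d → ℤ, (fun l ↦ a l * n l) ∈ M)
    {m : Fin d → ℤ} (hm : m ∈ M) : (fun l ↦ m l % a l) ∈ reducedReps a M := by
  rw [mem_reducedReps]
  refine ⟨fun l ↦ ⟨Int.emod_nonneg _ ?_, Int.emod_lt_of_pos _ ?_⟩, (emod_mem_iff haM).2 hm⟩
  · exact_mod_cast (ha l).ne'
  · exact_mod_cast ha l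

lemma reducedReps_nonempty (ha : ∀ l, 0 < a l) : (reducedReps a M).Nonempty :=
  ⟨0, mem_reducedReps.2 ⟨fun l ↦ ⟨le_rfl, by simpa using ha l⟩, M.zero_mem⟩⟩

open Classical in
lemma hasSum_subgroup_of_coset (ha : ∀ l, 0 < a l)
    (haM : ∀ n : Fin d → ℤ, (fun l ↦ a l * n l) ∈ M)
    {F : Fin d → ℤ → ℂ} {S : (Fin d → ℤ) → Fin d → ℂ}
    (hS : ∀ k l, HasSum (fun n : ℤ ↦ F l (k l + a l * n)) (S k l)) :
    HasSum (fun m : Fin d → ℤ ↦ if m ∈ M then ∏ l, F l (m l) else 0)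
      (∑ k ∈ reducedReps a M, ∏ l, S k l) := by
  have key : ∀ k ∈ reducedReps a M,
      HasSum (fun m : Fin d → ℤ ↦ if (fun l ↦ m l % a l) = k then ∏ l, F l (m l) else 0)
        (∏ l, S k l) := by
    intro k hk
    have hk' := (mem_reducedReps.1 hk).1
    let e : (Fin d → ℤ) → (Fin d → ℤ) := fun n l ↦ k l + a l * n l
    have he : Function.Injective e := by
      intro n n' h
      ext l
      have := congrFun h l
      simpa [e, (ha l).ne'] using this
    have hmod (n : Fin d → ℤ) : (fun l ↦ e n l % a l) = k := by
      ext l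
      simp [e, Int.emod_eq_of_lt (hk' l).1 (hk' l).2]
    rw [← he.hasSum_iff]
    · refine (hasSum_fin_pi_prod fun l ↦ hS k l).congr_fun fun n ↦ ?_
      simp only [Function.comp, hmod, if_true]
      rfl
    · intro m hm
      refine if_neg fun h ↦ hm ⟨fun l ↦ m l / a l, ?_⟩
      ext l
      simp [e, ← h, Int.emod_add_mul_ediv]
  refine (hasSum_sum key).congr_fun fun m ↦ ?_
  rw [Finset.sum_ite_eq]
  congr 1
  rw [mem_reducedReps, emod_mem_iff haM]
  simp only [eq_iff_iff]
  refine ⟨fun h ↦ ⟨fun l ↦ ⟨Int.emod_nonneg _ ?_, Int.emod_lt_of_pos _ ?_⟩, h⟩, fun h ↦ h.2⟩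
  · exact_mod_cast (ha l).ne'
  · exact_mod_cast ha l

open Complex Real in
open Classical in
lemma sum_reducedReps_exp (ha : ∀ l, 0 < a l)
    (haM : ∀ n : Fin d → ℤ, (fun l ↦ a l * n l) ∈ M)
    (hdual : ∀ m : Fin d → ℤ, m ∈ M ↔ ∀ k ∈ M, ∃ z : ℤ, ∑ l, (m l * k l / a l : ℚ) = z)
    (m : Fin d → ℤ) :
    ∑ k ∈ reducedReps a M, ∏ l, cexp (2 * π * I * (m l * k l / a l)) =
      if m ∈ M then ((reducedReps a M).card : ℂ) else 0 := by
  have hexp (k : Fin d → ℤ) : ∏ l, cexp (2 * π * I * (m l * k l / a l)) =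
      cexp ((2 * π * I) * ((∑ l, (m l * k l / a l : ℚ) : ℚ) : ℂ)) := by
    rw [← Complex.exp_sum, ← Finset.mul_sum]
    push_cast; rfl
  have hone (k : Fin d → ℤ) : ∏ l, cexp (2 * π * I * (m l * k l / a l)) = 1 ↔
      ∃ z : ℤ, ∑ l, (m l * k l / a l : ℚ) = z := by
    rw [hexp, Complex.exp_eq_one_iff]
    refine exists_congr fun z ↦ ?_
    rw [mul_comm, mul_left_inj' Complex.two_pi_I_ne_zero]
    norm_cast
  split_ifs with hm
  · rw [Finset.sum_congr rfl fun k hk ↦ (hone k).2 ((hdual m).1 hm k (mem_reducedReps.1 hk).2)]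
    simp
  · rw [hdual] at hm
    push Not at hm
    obtain ⟨k₀, hk₀, hne⟩ := hm
    have hχ : ∏ l, cexp (2 * π * I * (m l * k₀ l / a l)) ≠ 1 := by
      rw [Ne, hone]; push Not; exact hne
    set χ : (Fin d → ℤ) → ℂ := fun k ↦ ∏ l, cexp (2 * π * I * (m l * k l / a l)) with hχdef
    have hadd (k k' : Fin d → ℤ) : χ (k + k') = χ k * χ k' := by
      simp only [hχdef, ← Finset.prod_mul_distrib, ← Complex.exp_add]
      refine Finset.prod_congr rfl fun l _ ↦ ?_
      congr 1; push_cast [Pi.add_apply]; ring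
    have hmod (k : Fin d → ℤ) : χ (fun l ↦ k l % a l) = χ k := by
      have h1 : χ (fun l ↦ a l * (k l / a l)) = 1 := by
        rw [hone]
        refine ⟨∑ l, m l * (k l / a l), ?_⟩
        push_cast
        refine Finset.sum_congr rfl fun l _ ↦ ?_
        have : (a l : ℚ) ≠ 0 := by exact_mod_cast (ha l).ne'
        field_simp
      conv_rhs => rw [show k = (fun l ↦ k l % a l) + fun l ↦ a l * (k l / a l) by
        ext l; simp [Int.emod_add_mul_ediv]]
      rw [hadd, h1, mul_one]
    have hself {k : Fin d → ℤ} (hk : k ∈ reducedReps a M) (l) : k l % a l = k l :=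
      Int.emod_eq_of_lt ((mem_reducedReps.1 hk).1 l).1 ((mem_reducedReps.1 hk).1 l).2
    have hshift : ∑ k ∈ reducedReps a M, χ k * χ k₀ = ∑ k ∈ reducedReps a M, χ k := by
      refine Finset.sum_nbij' (fun k l ↦ (k l + k₀ l) % a l) (fun k l ↦ (k l - k₀ l) % a l)
        ?_ ?_ ?_ ?_ ?_
      · exact fun k hk ↦ emod_mem_reducedReps ha haM (m := k + k₀)
          (M.add_mem (mem_reducedReps.1 hk).2 hk₀)
      · exact fun k hk ↦ emod_mem_reducedReps ha haM (m := k - k₀)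
          (M.sub_mem (mem_reducedReps.1 hk).2 hk₀)
      · intro k hk
        ext l
        simp [hself hk]
      · intro k hk
        ext l
        simp [hself hk]
      · intro k _
        rw [← hadd, ← hmod (k + k₀)]
        rfl
    rw [← Finset.sum_mul] at hshift
    by_contra h0
    exact hχ (mul_left_cancel₀ h0 (hshift.trans (mul_one _).symm))

open Complex Real in
open Classical in
lemma hasSum_subgroup_of_char (ha : ∀ l, 0 < a l)
    (haM : ∀ n : Fin d → ℤ, (fun l ↦ a l * n l) ∈ M)
    (hdual : ∀ m : Fin d → ℤ, m ∈ M ↔ ∀ k ∈ M, ∃ z : ℤ, ∑ l, (m l * k l / a l : ℚ) = z)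
    {F : Fin d → ℤ → ℂ} {T : (Fin d → ℤ) → Fin d → ℂ}
    (hT : ∀ k l, HasSum (fun n : ℤ ↦ cexp (2 * π * I * (n * k l / a l)) * F l n) (T k l)) :
    HasSum (fun m : Fin d → ℤ ↦ if m ∈ M then ∏ l, F l (m l) else 0)
      (((reducedReps a M).card : ℂ)⁻¹ * ∑ k ∈ reducedReps a M, ∏ l, T k l) := by
  have hcard : ((reducedReps a M).card : ℂ) ≠ 0 := by
    exact_mod_cast (reducedReps_nonempty ha).card_pos.ne'
  have h := (hasSum_sum fun k (_ : k ∈ reducedReps a M) ↦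
    hasSum_fin_pi_prod fun l ↦ hT k l).mul_left ((reducedReps a M).card : ℂ)⁻¹
  refine h.congr_fun fun m ↦ ?_
  simp only [Finset.prod_mul_distrib, ← Finset.sum_mul]
  rw [sum_reducedReps_exp ha haM hdual]
  split_ifs <;> simp [hcard]

end reducedReps

section thetaSum

variable {d : ℕ} {a : Fin d → ℕ} {M : AddSubgroup (Fin d → ℤ)}

open Complex Real in
open Classical in
/-- The `m`-th term of the theta series of `M` weighted by `m i ^ 2 / a i`. -/
noncomputable def sqThetaTerm (a : Fin d → ℕ) (M : AddSubgroup (Fin d → ℤ)) (i : Fin d) (τ : ℂ)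
    (m : Fin d → ℤ) : ℂ :=
  if m ∈ M then (m i ^ 2 / a i) * ∏ l, cexp (π * I * τ * (m l ^ 2 / a l)) else 0

open Complex Real in
/-- The weighted theta series of a self-dual `M` satisfies an inversion formula, up to an error
term which does not depend on the weight. -/
lemma sqThetaTerm_transform (ha : ∀ l, 0 < a l)
    (haM : ∀ n : Fin d → ℤ, (fun l ↦ a l * n l) ∈ M)
    (hdual : ∀ m : Fin d → ℤ, m ∈ M ↔ ∀ k ∈ M, ∃ z : ℤ, ∑ l, (m l * k l / a l : ℚ) = z)
    {τ : ℂ} (hτ : 0 < τ.im) :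
    ∃ (S : Fin d → ℂ) (W : ℂ), ∀ i, HasSum (sqThetaTerm a M i (-1 / τ)) (S i) ∧
      HasSum (sqThetaTerm a M i τ)
        (((reducedReps a M).card : ℂ)⁻¹ * ((∏ l, ((√(a l : ℝ) : ℝ) : ℂ)) *
          ((-I * τ) ^ (-(1 / 2) : ℂ)) ^ d) * ((τ ^ 2)⁻¹ * S i - (2 * π * I * τ)⁻¹ * W)) := by
  classical
  choose U V hU hV hU' hV' using fun (k : Fin d → ℤ) (l : Fin d) ↦
    theta_char_coset_transform (k l) (ha l) hτ
  have hterm (i : Fin d) (σ : ℂ) (m : Fin d → ℤ) : sqThetaTerm a M i σ m =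
      if m ∈ M then ∏ l, (if l = i then (m l ^ 2 / a l : ℂ) else 1) *
        cexp (π * I * σ * (m l ^ 2 / a l)) else 0 := by
    rw [sqThetaTerm, Finset.prod_mul_distrib, Finset.prod_ite_eq']
    simp
  refine ⟨fun i ↦ ∑ k ∈ reducedReps a M, ∏ l, if l = i then V k l else U k l,
    ∑ k ∈ reducedReps a M, ∏ l, U k l, fun i ↦ ⟨?_, ?_⟩⟩
  · refine (hasSum_subgroup_of_coset ha haM (S := fun k l ↦ if l = i then V k l else U k l)
      (F := fun l n ↦ (if l = i then (n ^ 2 / a l : ℂ) else 1) *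
        cexp (π * I * (-1 / τ) * (n ^ 2 / a l))) fun k l ↦ ?_).congr_fun fun m ↦ hterm i _ m
    split_ifs
    · simpa using hV k l
    · simpa using hU k l
  · obtain ⟨h, hh⟩ : ∃ h : Fin d → ℂ, ∀ l, h l =
        ((√(a l : ℝ) : ℝ) : ℂ) * (-I * τ) ^ (-(1 / 2) : ℂ) := ⟨_, fun _ ↦ rfl⟩
    have key := hasSum_subgroup_of_char ha haM hdual (T := fun k l ↦ if l = i then
        h l * ((τ ^ 2)⁻¹ * V k l - (2 * π * I * τ)⁻¹ * U k l) else h l * U k l)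
      (F := fun l n ↦ (if l = i then (n ^ 2 / a l : ℂ) else 1) *
        cexp (π * I * τ * (n ^ 2 / a l))) fun k l ↦ by
      split_ifs
      · rw [hh]; exact hV' k l
      · simp only [one_mul, hh]; exact hU' k l
    have hsum := key.congr_fun fun m ↦ hterm i _ m
    convert hsum using 1
    have hprod : (∏ l, ((√(a l : ℝ) : ℝ) : ℂ)) * ((-I * τ) ^ (-(1 / 2) : ℂ)) ^ d = ∏ l, h l := by
      simp [hh, Finset.prod_mul_distrib]
    rw [hprod, mul_assoc]
    congr 1
    simp only [Finset.mul_sum, ← Finset.sum_sub_distrib]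
    refine Finset.sum_congr rfl fun k _ ↦ ?_
    rw [← Finset.mul_prod_erase _ _ (Finset.mem_univ i),
      ← Finset.mul_prod_erase _ (fun l ↦ if l = i then V k l else U k l) (Finset.mem_univ i),
      ← Finset.mul_prod_erase _ (fun l ↦ U k l) (Finset.mem_univ i),
      ← Finset.mul_prod_erase _ (fun l ↦ if l = i then
        h l * ((τ ^ 2)⁻¹ * V k l - (2 * π * I * τ)⁻¹ * U k l) else h l * U k l)
        (Finset.mem_univ i)]
    have hne {X Y : Fin d → ℂ} : ∏ l ∈ Finset.univ.erase i, (if l = i then X l else Y l) =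
        ∏ l ∈ Finset.univ.erase i, Y l :=
      Finset.prod_congr rfl fun l hl ↦ if_neg (Finset.ne_of_mem_erase hl)
    have hmul : ∏ l ∈ Finset.univ.erase i, h l * U k l =
        (∏ l ∈ Finset.univ.erase i, h l) * ∏ l ∈ Finset.univ.erase i, U k l :=
      Finset.prod_mul_distrib
    rw [hne, hne, hmul, if_pos rfl, if_pos rfl]
    ring

end thetaSum

section LevelOne

open UpperHalfPlane hiding I
open ModularGroup ModularForm SlashInvariantForm MatrixGroups Complex Real

open scoped Manifold

lemma slash_T_apply (f : ℍ → ℂ) (k : ℤ) (z : ℍ) : (f ∣[k] T) z = f ((1 : ℝ) +ᵥ z) := by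
  rw [SL_slash_apply, modular_T_smul, ModularGroup.denom_apply]
  simp [T]

lemma differentiableOn_upperHalfPlane_of_hasSum {g : ℂ → ℂ} {c : ℕ → ℂ}
    (hg : ∀ τ : ℂ, 0 < τ.im → HasSum (fun n ↦ c n * cexp (2 * π * I * τ) ^ n) (g τ)) :
    DifferentiableOn ℂ g {z | 0 < z.im} := by
  intro τ hτ
  have hτ' : 0 < τ.im := hτ
  set U : Set ℂ := {z | τ.im / 2 < z.im} with hU
  have hUo : IsOpen U := isOpen_lt continuous_const Complex.continuous_im
  have hτU : τ ∈ U := by simp [hU, hτ']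
  have hsum := (hg (τ.im / 2 * I) (by simpa using hτ')).summable.norm
  have hd : DifferentiableOn ℂ (fun z ↦ ∑' n, c n * cexp (2 * π * I * z) ^ n) U := by
    refine Complex.differentiableOn_tsum_of_summable_norm hsum (fun n ↦ by fun_prop) hUo ?_
    intro n z hz
    rw [norm_mul, norm_mul, norm_pow, norm_pow, Complex.norm_exp, Complex.norm_exp]
    refine mul_le_mul_of_nonneg_left
      (pow_le_pow_left₀ (Real.exp_nonneg _) (Real.exp_le_exp.2 ?_) n) (norm_nonneg _)
    have hz' : τ.im / 2 < z.im := hz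
    simp
    nlinarith [Real.pi_pos]
  have heq : g =ᶠ[nhds τ] fun z ↦ ∑' n, c n * cexp (2 * π * I * z) ^ n := by
    filter_upwards [hUo.mem_nhds hτU] with z hz
    exact (hg z (lt_trans (half_pos hτ') hz)).tsum_eq.symm
  exact ((hd.differentiableAt (hUo.mem_nhds hτU)).congr_of_eventuallyEq
    heq).differentiableWithinAt

/-- A level one modular form of weight 14 with vanishing constant term is zero, because `Δ`
divides it and there are no modular forms of weight 2. -/
lemma modularForm_weight_fourteen_eq_zero (f : ModularForm 𝒮ℒ 14)
    (h0 : (qExpansion 1 f).coeff 0 = 0) : f = 0 := by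
  have h2 : ∀ x : ModularForm 𝒮ℒ (14 - 12), x = 0 := by
    have : Module.rank ℂ (ModularForm 𝒮ℒ (14 - 12)) = 0 := levelOne_weight_two_rank_zero
    exact rank_zero_iff_forall_zero.1 this
  have h3 : f.toCuspForm h0 = 0 := CuspForm.discriminantEquiv.injective ((h2 _).trans (h2 _).symm)
  ext z
  have := DFunLike.congr_fun h3 z
  simpa using this

lemma coeff_eq_zero_of_hasSum_of_inversion {g : ℂ → ℂ} {c : ℕ → ℂ} {C : ℝ} (hC : 0 < C)
    (hc : c 0 = 0)
    (hg : ∀ τ : ℂ, 0 < τ.im → HasSum (fun n ↦ c n * cexp (2 * π * I * τ) ^ n) (g τ))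
    (hinv : ∀ τ : ℂ, 0 < τ.im → g τ = C * (τ ^ 14)⁻¹ * g (-1 / τ)) (n : ℕ) : c n = 0 := by
  have hne {τ : ℂ} (hτ : 0 < τ.im) : τ ≠ 0 := by rintro rfl; simp at hτ
  have him {τ : ℂ} (hτ : 0 < τ.im) : 0 < (-1 / τ).im := by
    rw [neg_div, one_div, Complex.neg_im, Complex.inv_im, neg_div, neg_neg]
    have := Complex.normSq_pos.mpr (hne hτ)
    positivity
  have hinv' (τ : ℂ) (hτ : 0 < τ.im) : g τ = (τ ^ 14)⁻¹ * g (-1 / τ) := by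
    have h2 {τ : ℂ} (hτ : 0 < τ.im) : g τ = (C : ℂ) ^ 2 * g τ := by
      conv_lhs => rw [hinv τ hτ, hinv _ (him hτ)]
      have := hne hτ
      rw [show -1 / (-1 / τ) = τ by field_simp]
      field_simp
    by_cases hz : g τ = 0
    · have := hinv τ hτ
      rw [hz, eq_comm, mul_eq_zero] at this
      rcases this with h | h
      · simp [hC.ne', hne hτ] at h
      · rw [hz, h, mul_zero]
    · have h1 : (C : ℂ) ^ 2 = 1 := mul_right_cancel₀ hz (by rw [← h2 hτ, one_mul])
      have h3 : C ^ 2 = 1 := by exact_mod_cast h1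
      have h4 : C = 1 := by nlinarith
      rw [hinv τ hτ, h4]; simp
  set f : ℍ → ℂ := fun z ↦ g z with hf
  have hfsum (z : ℍ) : HasSum (fun n ↦ c n • Function.Periodic.qParam 1 z ^ n) (f z) := by
    simpa [Function.Periodic.qParam] using hg z z.2
  have hS : f ∣[(14 : ℤ)] S = f := by
    ext z
    rw [slash_S_apply, hf]
    simp only
    rw [hinv' z z.2, mul_comm]
    congr 2
    simp [neg_div]
  have hT : f ∣[(14 : ℤ)] T = f := by
    ext z
    rw [slash_T_apply]
    refine (hfsum _).unique ((hfsum z).congr_fun fun n ↦ ?_)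
    congr 2
    simp [Function.Periodic.qParam, mul_add, Complex.exp_add]
  let F : ModularForm 𝒮ℒ 14 :=
    { toFun := f
      slash_action_eq' := by
        rintro A ⟨A, rfl⟩
        exact slash_action_generators_SL2Z hS hT A
      holo' := by
        rw [UpperHalfPlane.mdifferentiable_iff]
        refine (differentiableOn_upperHalfPlane_of_hasSum hg).congr fun z hz ↦ ?_
        simp [hf, ofComplex_apply_of_im_pos hz]
      bdd_at_cusps' := by
        intro x hx
        rw [Subgroup.IsArithmetic.isCusp_iff_isCusp_SL2Z] at hx
        rw [OnePoint.isBoundedAt_iff_forall_SL2Z hx]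
        intro γ _
        rw [slash_action_generators_SL2Z hS hT]
        exact isBoundedAtImInfty_of_hasSum_qExpansion one_pos hfsum }
  have hcoeff (m : ℕ) : c m = (qExpansion 1 F).coeff m :=
    ModularFormClass.qExpansion_coeff_unique one_pos one_mem_strictPeriods_SL (f := F) hfsum m
  have hF : F = 0 := modularForm_weight_fourteen_eq_zero F (by rw [← hcoeff, hc])
  rw [hcoeff, hF, FunLike.coe_zero, qExpansion_zero]
  simp

end LevelOne

section rootSums

variable {a : Fin 24 → ℕ} {M : AddSubgroup (Fin 24 → ℤ)}

lemma finite_setOf_sum_sq_div_eq {d : ℕ} {a : Fin d → ℕ} (ha : ∀ l, 0 < a l) :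
    {m : Fin d → ℤ | ∑ l, (m l ^ 2 / a l : ℚ) = 2}.Finite := by
  refine (Fintype.piFinset fun l ↦ Finset.Icc (-(2 * a l : ℤ)) (2 * a l)).finite_toSet.subset ?_
  intro m hm
  simp only [Finset.mem_coe, Fintype.mem_piFinset, Finset.mem_Icc, ← abs_le]
  intro l
  have h1 : (m l ^ 2 / a l : ℚ) ≤ 2 := by
    rw [← show ∑ l, (m l ^ 2 / a l : ℚ) = 2 from hm]
    exact Finset.single_le_sum (f := fun l ↦ (m l ^ 2 / a l : ℚ))
      (fun l _ ↦ by positivity) (Finset.mem_univ l)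
  have h2 : (0 : ℚ) < a l := by exact_mod_cast ha l
  rw [div_le_iff₀ h2] at h1
  have h3 : m l ^ 2 ≤ 2 * a l := by exact_mod_cast h1
  have h4 : (1 : ℤ) ≤ a l := by exact_mod_cast ha l
  refine abs_le_of_sq_le_sq ?_ (by positivity)
  nlinarith

open Complex in
lemma neg_I_mul_cpow_neg_half_pow {τ : ℂ} : ((-I * τ) ^ (-(1 / 2) : ℂ)) ^ 24 = (τ ^ 12)⁻¹ := by
  rw [← Complex.cpow_nat_mul, show ((24 : ℕ) : ℂ) * -(1 / 2) = -((12 : ℕ) : ℂ) by norm_num,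
    Complex.cpow_neg, Complex.cpow_natCast, mul_pow, show (-I) ^ 12 = 1 by
      rw [neg_pow, show (12 : ℕ) = 4 * 3 from rfl, pow_mul I, I_pow_four]; norm_num, one_mul]

open Complex Real in
lemma sqThetaTerm_eq {d : ℕ} {a : Fin d → ℕ} {M : AddSubgroup (Fin d → ℤ)} {N : (Fin d → ℤ) → ℕ}
    (hN : ∀ m ∈ M, ∑ l, (m l ^ 2 / a l : ℚ) = 2 * N m) (i : Fin d) (τ : ℂ) (m : Fin d → ℤ) :
    sqThetaTerm a M i τ m = (M : Set (Fin d → ℤ)).indicator (fun m ↦ (m i ^ 2 / a i : ℂ)) m *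
      cexp (2 * π * I * τ) ^ N m := by
  classical
  rw [sqThetaTerm, Set.indicator_apply]
  simp only [SetLike.mem_coe]
  split_ifs with hm
  · congr 1
    have h : ∑ l, (m l ^ 2 / a l : ℂ) = 2 * N m := by
      exact_mod_cast congrArg (Rat.cast (K := ℂ)) (hN m hm)
    rw [← Complex.exp_sum, ← Finset.mul_sum, h, ← Complex.exp_nat_mul]
    congr 1; ring
  · simp

open Complex Real in
/-- Over the norm two vectors of an even unimodular lattice of rank 24 with orthogonal vectors of
norms `a i`, whose coordinates are the inner products with these vectors, the sum of the squares
of the `i`-th coordinates is proportional to `a i`. -/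
lemma exists_finset_sum_sq_eq (ha : ∀ l, 0 < a l)
    (haM : ∀ n : Fin 24 → ℤ, (fun l ↦ a l * n l) ∈ M)
    (hdual : ∀ m : Fin 24 → ℤ, m ∈ M ↔ ∀ k ∈ M, ∃ z : ℤ, ∑ l, (m l * k l / a l : ℚ) = z)
    (heven : ∀ m ∈ M, ∃ z : ℤ, ∑ l, (m l ^ 2 / a l : ℚ) = 2 * z) :
    ∃ s : Finset (Fin 24 → ℤ), (∀ m, m ∈ s ↔ m ∈ M ∧ ∑ l, (m l ^ 2 / a l : ℚ) = 2) ∧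
      ∀ i, 12 * ∑ m ∈ s, (m i : ℚ) ^ 2 = s.card * a i := by
  classical
  have hex : ∀ m : Fin 24 → ℤ, ∃ n : ℕ, m ∈ M → ∑ l, (m l ^ 2 / a l : ℚ) = 2 * n := by
    intro m
    by_cases hm : m ∈ M
    · obtain ⟨z, hz⟩ := heven m hm
      have h0 : (0 : ℚ) ≤ ∑ l, (m l ^ 2 / a l : ℚ) := Finset.sum_nonneg fun l _ ↦ by positivity
      rw [hz] at h0
      have h1 : 0 ≤ z := by
        have : (0 : ℚ) ≤ z := by linarith
        exact_mod_cast this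
      lift z to ℕ using h1
      exact ⟨z, fun _ ↦ by simpa using hz⟩
    · exact ⟨0, fun h ↦ absurd h hm⟩
  choose N hN using hex
  set w : Fin 24 → (Fin 24 → ℤ) → ℂ := fun i ↦
    (M : Set (Fin 24 → ℤ)).indicator fun m ↦ (m i ^ 2 / a i : ℂ) with hw
  have hterm := sqThetaTerm_eq (a := a) (M := M) hN
  set c : Fin 24 → ℕ → ℂ := fun i n ↦ ∑' m : N ⁻¹' {n}, w i m with hc
  have hsum {τ : ℂ} (hτ : 0 < τ.im) (i : Fin 24) : HasSum (fun n ↦ c i n * cexp (2 * π * I * τ) ^ n)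
      (∑' m, sqThetaTerm a M i τ m) := by
    obtain ⟨S, W, h⟩ := sqThetaTerm_transform ha haM hdual hτ
    have h1 := (h i).2.summable.hasSum.tsum_fiberwise N
    refine h1.congr_fun fun n ↦ ?_
    rw [hc, ← tsum_mul_right]
    refine tsum_congr fun m ↦ ?_
    rw [hterm, show N m = n from m.2]
  have hc0 (i : Fin 24) : c i 0 = 0 := by
    have hz : ∀ m : N ⁻¹' {0}, w i m = 0 := by
      rintro ⟨m, hm⟩
      rw [hw, Set.indicator_apply_eq_zero]
      intro hmM
      have h1 := hN m hmM
      rw [show N m = 0 from hm, Nat.cast_zero, mul_zero,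
        Finset.sum_eq_zero_iff_of_nonneg fun l _ ↦ by positivity] at h1
      exact_mod_cast congrArg (Rat.cast (K := ℂ)) (h1 i (Finset.mem_univ i))
    simp only [hc, hz, tsum_zero]
  have hcij (i j : Fin 24) : c i 1 = c j 1 := by
    refine sub_eq_zero.1 (coeff_eq_zero_of_hasSum_of_inversion
      (C := ((reducedReps a M).card : ℝ)⁻¹ * ∏ l, √(a l : ℝ)) (c := fun n ↦ c i n - c j n)
      (g := fun τ ↦ ∑' m, sqThetaTerm a M i τ m - ∑' m, sqThetaTerm a M j τ m) ?_ ?_ ?_ ?_ 1)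
    · have h1 : (0 : ℝ) < (reducedReps a M).card := by
        exact_mod_cast (reducedReps_nonempty ha).card_pos
      have h2 : 0 < ∏ l, √(a l : ℝ) :=
        Finset.prod_pos fun l _ ↦ Real.sqrt_pos.2 (by exact_mod_cast ha l)
      exact mul_pos (inv_pos.2 h1) h2
    · simp [hc0]
    · intro τ hτ
      simpa only [sub_mul] using (hsum hτ i).sub (hsum hτ j)
    · intro τ hτ
      obtain ⟨S, W, h⟩ := sqThetaTerm_transform ha haM hdual hτ
      simp only [(h _).1.tsum_eq, (h _).2.tsum_eq, neg_I_mul_cpow_neg_half_pow]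
      rw [Complex.ofReal_mul, Complex.ofReal_inv, Complex.ofReal_natCast, Complex.ofReal_prod,
        show τ ^ 14 = τ ^ 12 * τ ^ 2 by ring, mul_inv (τ ^ 12)]
      ring
  have hfin : {m : Fin 24 → ℤ | m ∈ M ∧ ∑ l, (m l ^ 2 / a l : ℚ) = 2}.Finite :=
    (finite_setOf_sum_sq_div_eq ha).subset fun m hm ↦ hm.2
  have hmem (m) : m ∈ hfin.toFinset ↔ m ∈ M ∧ ∑ l, (m l ^ 2 / a l : ℚ) = 2 := by simp
  refine ⟨hfin.toFinset, hmem, ?_⟩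
  set s := hfin.toFinset
  have hc1 (i : Fin 24) : c i 1 = ((∑ m ∈ s, (m i ^ 2 / a i : ℚ) : ℚ) : ℂ) := by
    rw [hc]
    simp only
    rw [tsum_subtype (N ⁻¹' {1}) (w i), tsum_eq_sum (s := s)]
    · push_cast
      refine Finset.sum_congr rfl fun m hm ↦ ?_
      obtain ⟨h1, h2⟩ := (hmem m).1 hm
      rw [hN m h1] at h2
      have h3 : N m = 1 := by
        have : (N m : ℚ) = 1 := by linarith
        exact_mod_cast this
      rw [Set.indicator_of_mem (show m ∈ N ⁻¹' {1} from h3)]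
      exact Set.indicator_of_mem h1 _
    · intro m hm
      by_cases h1 : m ∈ N ⁻¹' {1}
      · rw [Set.indicator_of_mem h1]
        refine Set.indicator_of_notMem (fun h2 ↦ ?_) _
        refine hm ((hmem m).2 ⟨h2, ?_⟩)
        rw [hN m h2, show N m = 1 from h1]
        norm_num
      · exact Set.indicator_of_notMem h1 _
  have hq (i j : Fin 24) : ∑ m ∈ s, (m i ^ 2 / a i : ℚ) = ∑ m ∈ s, (m j ^ 2 / a j : ℚ) := by
    have := hcij i j
    rw [hc1, hc1] at this
    exact_mod_cast this
  intro i
  have htot : ∑ j : Fin 24, ∑ m ∈ s, (m j ^ 2 / a j : ℚ) = 2 * s.card := by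
    rw [Finset.sum_comm, Finset.sum_congr rfl fun m hm ↦ ((hmem m).1 hm).2]
    simp [mul_comm]
  rw [Finset.sum_congr rfl fun j _ ↦ hq j i, Finset.sum_const, Finset.card_univ, Fintype.card_fin,
    ← Finset.sum_div, nsmul_eq_mul] at htot
  have hai : (a i : ℚ) ≠ 0 := by exact_mod_cast (ha i).ne'
  field_simp at htot
  push_cast at htot
  linarith

end rootSums

section orthogonalBasis

lemma exists_orthogonal_basis_zero_eq {K V : Type*} [Field K] [Invertible (2 : K)] [AddCommGroup V]
    [Module K V] [FiniteDimensional K V] {B : V →ₗ[K] V →ₗ[K] K} (hB : ∀ x y, B x y = B y x) {x : V}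
    (hx : B x x ≠ 0) {d : ℕ} (hd : Module.finrank K V = d + 1) :
    ∃ v : Module.Basis (Fin (d + 1)) K V, B.IsOrthoᵢ v ∧ v 0 = x := by
  have hx0 : x ≠ 0 := by rintro rfl; exact hx (by simp)
  have hcompl := LinearMap.isCompl_span_singleton_orthogonal hx
  rw [← Submodule.finrank_add_eq_of_isCompl hcompl.symm, finrank_span_singleton hx0] at hd
  let B' : LinearMap.BilinForm K ((K ∙ x).orthogonalBilin B) :=
    B.domRestrict₁₂ ((K ∙ x).orthogonalBilin B) ((K ∙ x).orthogonalBilin B)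
  obtain ⟨v₀, hv₀⟩ := LinearMap.BilinForm.exists_orthogonal_basis (B := B')
    ⟨fun y z ↦ hB y z⟩
  obtain ⟨v', hv'⟩ : ∃ v : Module.Basis (Fin d) K ((K ∙ x).orthogonalBilin B), B'.IsOrthoᵢ v := by
    rw [← Nat.succ.inj hd]
    exact ⟨v₀, hv₀⟩
  have hxv (i) : B x (v' i) = 0 := (v' i).prop _ (Submodule.mem_span_singleton_self x)
  refine ⟨Module.Basis.mkFinCons x v' ?_ ?_, ?_,
    by rw [Module.Basis.coe_mkFinCons, Fin.cons_zero]⟩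
  · intro c y hy hc
    rw [add_eq_zero_iff_neg_eq] at hc
    rw [← hc, Submodule.neg_mem_iff] at hy
    have := Submodule.disjoint_def.1 hcompl.disjoint (c • x)
      (Submodule.smul_mem _ _ <| Submodule.mem_span_singleton_self _) hy
    exact (smul_eq_zero.1 this).resolve_right hx0
  · intro y
    refine ⟨-B x y / B x x, fun z hz ↦ ?_⟩
    obtain ⟨c, rfl⟩ := Submodule.mem_span_singleton.1 hz
    rw [map_smul, LinearMap.smul_apply, map_add, map_smul, smul_eq_mul, smul_eq_mul,
      div_mul_cancel₀ _ hx, add_neg_cancel, mul_zero]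
  · rw [Module.Basis.coe_mkFinCons]
    intro j i
    refine Fin.cases ?_ (fun i ↦ ?_) i <;> refine Fin.cases ?_ (fun j ↦ ?_) j <;> intro hij <;>
      simp only [Function.onFun, Fin.cons_zero, Fin.cons_succ, Function.comp_apply]
    · exact (hij rfl).elim
    · exact (hB _ _).trans (hxv j)
    · exact hxv i
    · exact hv' (ne_of_apply_ne _ hij)

lemma exists_pos_nsmul_mem_of_span_eq_top {V : Type*} [AddCommGroup V] [Module ℚ V]
    {L : Submodule ℤ V} (hspan : Submodule.span ℚ (L : Set V) = ⊤) (v : V) :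
    ∃ n : ℕ, 0 < n ∧ n • v ∈ L := by
  have hv : v ∈ Submodule.span ℚ (L : Set V) := hspan ▸ Submodule.mem_top
  induction hv using Submodule.span_induction with
  | mem x hx => exact ⟨1, one_pos, by simpa using hx⟩
  | zero => exact ⟨1, one_pos, by simp⟩
  | add x y _ _ hx hy =>
    obtain ⟨m, hm, hx⟩ := hx
    obtain ⟨n, hn, hy⟩ := hy
    refine ⟨m * n, Nat.mul_pos hm hn, ?_⟩
    rw [smul_add, mul_comm, mul_smul, mul_comm, mul_smul]
    exact L.add_mem (L.nsmul_mem hx n) (L.nsmul_mem hy m)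
  | smul q x _ hx =>
    obtain ⟨m, hm, hx⟩ := hx
    refine ⟨m * q.den, Nat.mul_pos hm q.den_pos, ?_⟩
    have h : (m * q.den) • q • x = q.num • m • x := by
      rw [← Nat.cast_smul_eq_nsmul ℚ, ← Nat.cast_smul_eq_nsmul ℚ m, ← Int.cast_smul_eq_zsmul ℚ,
        smul_smul, smul_smul]
      congr 1
      rw [Nat.cast_mul, mul_assoc, mul_comm (q.den : ℚ), Rat.mul_den_eq_num, mul_comm]
    rw [h]
    exact L.smul_mem _ hx

end orthogonalBasis

section lattice

variable {V : Type*} [AddCommGroup V] [Module ℚ V] {L : Submodule ℤ V} {B : V →ₗ[ℚ] V →ₗ[ℚ] ℚ}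

lemma sum_sq_root_inner_basis
    (hint : ∀ x ∈ L, ∀ y ∈ L, ∃ n : ℤ, B x y = (n : ℚ))
    (hpos : ∀ x ∈ L, x ≠ 0 → 0 < B x x)
    (heven : ∀ x ∈ L, ∃ n : ℤ, B x x = 2 * (n : ℚ))
    (hunimod : ∀ v : V, (∀ y ∈ L, ∃ n : ℤ, B v y = (n : ℚ)) → v ∈ L)
    (e : Module.Basis (Fin 24) ℚ V) (heL : ∀ i, e i ∈ L) (he : B.IsOrthoᵢ e) (i : Fin 24) :
    12 * ∑ᶠ r ∈ {x : V | x ∈ L ∧ B x x = 2}, (B (e i) r) ^ 2 =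
      ({x : V | x ∈ L ∧ B x x = 2}.ncard : ℚ) * B (e i) (e i) := by
  classical
  have hex (l : Fin 24) : ∃ n : ℕ, 0 < n ∧ B (e l) (e l) = n := by
    obtain ⟨z, hz⟩ := hint _ (heL l) _ (heL l)
    have h := hpos _ (heL l) (e.ne_zero l)
    rw [hz] at h
    have h' : 0 < z := by exact_mod_cast h
    lift z to ℕ using h'.le
    exact ⟨z, by exact_mod_cast h', by simpa using hz⟩
  choose a ha hBe using hex
  have ha' (l) : (a l : ℚ) ≠ 0 := by exact_mod_cast (ha l).ne'
  let ψ : (Fin 24 → ℤ) →+ V :=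
    { toFun := fun m ↦ ∑ l, (m l / a l : ℚ) • e l
      map_zero' := by simp
      map_add' := fun m k ↦ by simp [add_div, add_smul, Finset.sum_add_distrib] }
  have hψ (m) : ψ m = ∑ l, (m l / a l : ℚ) • e l := rfl
  have hBψ (m l) : B (e l) (ψ m) = m l := by
    rw [hψ, map_sum, Finset.sum_eq_single l]
    · rw [map_smul, smul_eq_mul, hBe, div_mul_cancel₀ _ (ha' l)]
    · intro j _ hj
      rw [map_smul, he hj.symm, smul_zero]
    · simp
  have hψψ (m k) : B (ψ m) (ψ k) = ∑ l, (m l * k l / a l : ℚ) := by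
    rw [hψ m, map_sum, LinearMap.sum_apply]
    refine Finset.sum_congr rfl fun l _ ↦ ?_
    rw [map_smul, LinearMap.smul_apply, hBψ, smul_eq_mul, div_mul_eq_mul_div]
  have hsq (m) : B (ψ m) (ψ m) = ∑ l, (m l ^ 2 / a l : ℚ) := by
    simp only [hψψ, sq]
  have hsurj : ∀ x ∈ L, ∃ m, ψ m = x := by
    intro x hx
    choose m hm using fun l ↦ hint _ (heL l) x hx
    refine ⟨m, ?_⟩
    rw [hψ, ← e.sum_repr x]
    refine Finset.sum_congr rfl fun l _ ↦ ?_
    congr 1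
    rw [div_eq_iff (ha' l), ← hm l]
    conv_lhs => rw [← e.sum_repr x]
    rw [map_sum, Finset.sum_eq_single l]
    · rw [map_smul, smul_eq_mul, hBe]
    · intro j _ hj
      rw [map_smul, he hj.symm, smul_zero]
    · simp
  have hinj : Function.Injective ψ := by
    intro m k h
    ext l
    have := congrArg (B (e l)) h
    rw [hBψ, hBψ] at this
    exact_mod_cast this
  have hmemM (m : Fin 24 → ℤ) : m ∈ L.toAddSubgroup.comap ψ ↔ ψ m ∈ L := Iff.rfl
  obtain ⟨s, hs, hsum⟩ := exists_finset_sum_sq_eq (a := a) (M := L.toAddSubgroup.comap ψ) ha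
    (by
      intro n
      rw [hmemM, hψ]
      refine L.sum_mem fun l _ ↦ ?_
      rw [show (((a l : ℤ) * n l : ℤ) / a l : ℚ) = n l by
        push_cast; rw [mul_div_cancel_left₀ _ (ha' l)], Int.cast_smul_eq_zsmul]
      exact L.smul_mem _ (heL l))
    (by
      intro m
      refine ⟨fun hm k hk ↦ ?_, fun h ↦ hunimod _ fun y hy ↦ ?_⟩
      · rw [← hψψ]
        exact hint _ hm _ hk
      · obtain ⟨k, rfl⟩ := hsurj y hy
        rw [hψψ]
        exact h k hy)
    (by
      intro m hm
      rw [← hsq]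
      exact heven _ hm)
  have hR : {x : V | x ∈ L ∧ B x x = 2} = (s.image ψ : Finset V) := by
    ext x
    simp only [Set.mem_ofPred_eq, Finset.coe_image, Set.mem_image, Finset.mem_coe]
    constructor
    · rintro ⟨hx, hx2⟩
      obtain ⟨m, rfl⟩ := hsurj x hx
      exact ⟨m, (hs m).2 ⟨hx, by rw [← hsq, hx2]⟩, rfl⟩
    · rintro ⟨m, hm, rfl⟩
      obtain ⟨h1, h2⟩ := (hs m).1 hm
      exact ⟨h1, by rw [hsq, h2]⟩
  rw [hR, finsum_mem_coe_finset, Set.ncard_coe_finset, Finset.card_image_of_injective _ hinj,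
    Finset.sum_image hinj.injOn, hBe, ← hsum i]
  simp only [hBψ]

end lattice

/-- (Venkov) For a Niemeier lattice `N` with root set `R` and any `y ∈ N`,
`12·∑_{r ∈ R} B(y,r)² = |R|·B(y,y)`, i.e. `∑_{r ∈ R} B(y,r)² = 2h·B(y,y)` with
`h = |R|/24` the Coxeter number. -/
theorem niemeier_sum_of_squares_of_root_inner_products
    (V : Type*) [AddCommGroup V] [Module ℚ V]
    (L : Submodule ℤ V) (hfg : L.FG)
    (hspan : Submodule.span ℚ (L : Set V) = ⊤)
    (hrank : Module.finrank ℚ V = 24)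
    (B : V →ₗ[ℚ] V →ₗ[ℚ] ℚ)
    (hsymm : ∀ x y : V, B x y = B y x)
    (hint : ∀ x ∈ L, ∀ y ∈ L, ∃ n : ℤ, B x y = (n : ℚ))
    (hpos : ∀ x ∈ L, x ≠ 0 → 0 < B x x)
    (heven : ∀ x ∈ L, ∃ n : ℤ, B x x = 2 * (n : ℚ))
    (hunimod : ∀ v : V, (∀ y ∈ L, ∃ n : ℤ, B v y = (n : ℚ)) → v ∈ L) :
    ∀ y ∈ L,
      12 * ∑ᶠ r ∈ {x : V | x ∈ L ∧ B x x = 2}, (B y r) ^ 2 =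
        ({x : V | x ∈ L ∧ B x x = 2}.ncard : ℚ) * B y y := by
  intro y hy
  obtain rfl | hy0 := eq_or_ne y 0
  · simp
  have : FiniteDimensional ℚ V := Module.finite_of_finrank_pos (by omega)
  have hBy := hpos y hy hy0
  let _ : Invertible (2 : ℚ) := invertibleOfNonzero two_ne_zero
  obtain ⟨v, hv, rfl⟩ := exists_orthogonal_basis_zero_eq hsymm hBy.ne' (d := 23) hrank
  choose n hn hnL using fun i ↦ exists_pos_nsmul_mem_of_span_eq_top hspan (v i)
  have hn' (i) : (n i : ℚ) ≠ 0 := by exact_mod_cast (hn i).ne'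
  set e : Module.Basis (Fin 24) ℚ V := v.isUnitSMul fun i ↦ (hn' i).isUnit
  have hev (i) : e i = (n i : ℚ) • v i := v.isUnitSMul_apply _ i
  have key := sum_sq_root_inner_basis hint hpos heven hunimod e
    (fun i ↦ by rw [hev, Nat.cast_smul_eq_nsmul]; exact hnL i)
    (fun i j hij ↦ by
      have : B (v i) (v j) = 0 := hv hij
      simp [Function.onFun, hev, this]) 0
  simp only [hev, map_smul, LinearMap.smul_apply, smul_eq_mul, mul_pow] at key
  rw [← mul_finsum_mem] at key
  refine mul_left_cancel₀ (pow_ne_zero 2 (hn' 0)) ?_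
  linear_combination key
end

section
/- Let N be a Niemeier lattice with set of roots R = {r ∈ N : B(r, r) = 2}, and fix a ℚ-linear functional f on N ⊗ ℚ with f(r) ≠ 0 for all r ∈ R. Then the sum of the positive roots (those r ∈ R with f(r) > 0) lies in 2N; equivalently, the Weyl vector ρ, which a priori lies in N ⊗ ℚ, lies in N. -/
section Series
open Complex

theorem hasSum_mul_of_hasSum {α β : Type*} {f : α → ℂ} {g : β → ℂ} {s t : ℂ}
    (hf : HasSum f s) (hg : HasSum g t) : HasSum (fun p : α × β ↦ f p.1 * g p.2) (s * t) :=
  hf.mul hg (summable_mul_of_summable_norm hf.summable.norm hg.summable.norm)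

theorem hasSum_pi_prod {n : ℕ} (f : Fin n → ℤ → ℂ) (hf : ∀ i, Summable (f i)) :
    HasSum (fun k : Fin n → ℤ ↦ ∏ i, f i (k i)) (∏ i, ∑' m, f i m) := by
  induction n with
  | zero =>
    simp
  | succ n ih =>
    have h0 := (hf 0).hasSum
    have h1 := ih (fun i ↦ f i.succ) fun i ↦ hf i.succ
    have h := hasSum_mul_of_hasSum h0 h1
    rw [Fin.prod_univ_succ]
    rw [← (Fin.consEquiv fun _ ↦ ℤ).hasSum_iff]
    convert! h using 2 with p
    simp [Fin.prod_univ_succ, Fin.consEquiv]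

theorem summable_exp_neg_sq_add {y : ℝ} (hy : 0 < y) (R : ℝ) :
    Summable fun m : ℤ ↦ Real.exp (-y * m ^ 2 + R * |(m : ℝ)|) := by
  have h := summable_pow_mul_jacobiTheta₂_term_bound (R / (2 * Real.pi))
    (div_pos hy Real.pi_pos) 0
  refine h.congr fun m ↦ ?_
  rw [pow_zero, one_mul]
  congr 1
  push_cast
  field_simp
  ring

theorem summable_exp_sum_neg_sq_add {n : ℕ} {y : Fin n → ℝ} (hy : ∀ i, 0 < y i) (R : ℝ) :
    Summable fun k : Fin n → ℤ ↦ Real.exp (∑ i, (-y i * k i ^ 2 + R * |(k i : ℝ)|)) := by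
  have h := (hasSum_pi_prod
    (fun i m ↦ ((Real.exp (-y i * m ^ 2 + R * |(m : ℝ)|) : ℝ) : ℂ))
    fun i ↦ Complex.ofRealCLM.summable (summable_exp_neg_sq_add (hy i) R)).summable.norm
  refine h.congr fun k ↦ ?_
  rw [norm_prod, Real.exp_sum]
  refine Finset.prod_congr rfl fun i _ ↦ ?_
  rw [Complex.norm_real, Real.norm_of_nonneg (Real.exp_pos _).le]

variable {α : Type*} {c b : α → ℂ}

theorem summable_exp_weight_mul (h : ∀ R : ℝ, Summable fun x ↦ ‖c x‖ * Real.exp (R * ‖b x‖))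
    (R : ℝ) :
    Summable fun x ↦ ‖c x * b x‖ * Real.exp (R * ‖b x‖) := by
  refine Summable.of_nonneg_of_le (fun x ↦ by positivity) (fun x ↦ ?_) (h (R + 1))
  rw [norm_mul, mul_assoc, add_mul, one_mul, add_comm, Real.exp_add]
  gcongr
  linarith [Real.add_one_le_exp ‖b x‖]

theorem hasDerivAt_tsum_mul_exp (h : ∀ R : ℝ, Summable fun x ↦ ‖c x‖ * Real.exp (R * ‖b x‖))
    (z : ℂ) :
    HasDerivAt (fun z ↦ ∑' x, c x * cexp (b x * z)) (∑' x, c x * b x * cexp (b x * z)) z := by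
  have hd : ∀ x, Differentiable ℂ fun z ↦ c x * cexp (b x * z) := fun x ↦ by fun_prop
  have hU : IsOpen (Metric.ball (0 : ℂ) (‖z‖ + 1)) := Metric.isOpen_ball
  have hz : z ∈ Metric.ball (0 : ℂ) (‖z‖ + 1) := by simp
  have hle : ∀ x, ∀ w ∈ Metric.ball (0 : ℂ) (‖z‖ + 1),
      ‖c x * cexp (b x * w)‖ ≤ ‖c x‖ * Real.exp ((‖z‖ + 1) * ‖b x‖) := by
    intro x w hw
    rw [norm_mul]
    gcongr
    refine (norm_exp_le_exp_norm _).trans (Real.exp_le_exp.mpr ?_)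
    rw [norm_mul, mul_comm]
    gcongr
    exact (mem_ball_zero_iff.mp hw).le
  have h1 := hasSum_deriv_of_summable_norm (h (‖z‖ + 1)) (fun x ↦ (hd x).differentiableOn) hU hle hz
  have h2 := (differentiableOn_tsum_of_summable_norm (h (‖z‖ + 1))
    (fun x ↦ (hd x).differentiableOn) hU hle).differentiableAt (hU.mem_nhds hz)
  have h3 := h2.hasDerivAt
  rw [← h1.tsum_eq] at h3
  refine h3.congr_deriv (tsum_congr fun x ↦ ?_)
  have : HasDerivAt (fun z ↦ c x * cexp (b x * z)) (c x * (cexp (b x * z) * (b x * 1))) z :=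
    (((hasDerivAt_id z).const_mul (b x)).cexp).const_mul (c x)
  rw [this.deriv]
  ring

theorem deriv_deriv_tsum_mul_exp (h : ∀ R : ℝ, Summable fun x ↦ ‖c x‖ * Real.exp (R * ‖b x‖)) :
    deriv (deriv fun z ↦ ∑' x, c x * cexp (b x * z)) 0 = ∑' x, c x * b x ^ 2 := by
  have h1 : (deriv fun z ↦ ∑' x, c x * cexp (b x * z)) =
      fun z ↦ ∑' x, c x * b x * cexp (b x * z) :=
    funext fun z ↦ (hasDerivAt_tsum_mul_exp h z).deriv
  rw [h1, (hasDerivAt_tsum_mul_exp (summable_exp_weight_mul h) 0).deriv]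
  refine tsum_congr fun x ↦ ?_
  simp [pow_two, mul_assoc]

end Series

section Theta
open Complex

variable {n : ℕ}

/-- The pairing `∑ kᵢ lᵢ / aᵢ` on `ℤⁿ`. -/
noncomputable def diagPairing (a : Fin n → ℕ) (k l : Fin n → ℤ) : ℝ :=
  ∑ i, (k i : ℝ) * l i / a i

/-- `Λ ⊆ ℤⁿ` is its own dual with respect to `diagPairing a`. -/
structure IsDiagSelfDual (a : Fin n → ℕ) (Λ : Set (Fin n → ℤ)) : Prop where
  pos : ∀ i, 0 < a i
  mem_iff : ∀ k, k ∈ Λ ↔ ∀ l ∈ Λ, ∃ m : ℤ, diagPairing a k l = m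

theorem diagPairing_comm (a : Fin n → ℕ) (k l : Fin n → ℤ) :
    diagPairing a k l = diagPairing a l k := by
  simp only [diagPairing, mul_comm]

theorem diagPairing_add_right (a : Fin n → ℕ) (k l l' : Fin n → ℤ) :
    diagPairing a k (l + l') = diagPairing a k l + diagPairing a k l' := by
  simp only [diagPairing, ← Finset.sum_add_distrib]
  refine Finset.sum_congr rfl fun i _ ↦ ?_
  simp only [Pi.add_apply]
  push_cast
  ring

theorem diagPairing_mul_right {a : Fin n → ℕ} (ha : ∀ i, 0 < a i) (k m : Fin n → ℤ) :
    diagPairing a k (fun i ↦ a i * m i) = ((∑ i, k i * m i : ℤ) : ℝ) := by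
  rw [diagPairing]
  push_cast
  refine Finset.sum_congr rfl fun i _ ↦ ?_
  have : (a i : ℝ) ≠ 0 := by exact_mod_cast (ha i).ne'
  field_simp

theorem diagPairing_self_nonneg (a : Fin n → ℕ) (k : Fin n → ℤ) : 0 ≤ diagPairing a k k :=
  Finset.sum_nonneg fun _ _ ↦ div_nonneg (mul_self_nonneg _) (Nat.cast_nonneg _)

namespace IsDiagSelfDual
variable {a : Fin n → ℕ} {Λ : Set (Fin n → ℤ)}

theorem pairing_int (h : IsDiagSelfDual a Λ) {k l : Fin n → ℤ} (hk : k ∈ Λ) (hl : l ∈ Λ) :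
    ∃ m : ℤ, diagPairing a k l = m := (h.mem_iff k).mp hk l hl

theorem add_mem (h : IsDiagSelfDual a Λ) {k l : Fin n → ℤ} (hk : k ∈ Λ) (hl : l ∈ Λ) :
    k + l ∈ Λ := by
  refine (h.mem_iff _).mpr fun x hx ↦ ?_
  obtain ⟨p, hp⟩ := h.pairing_int hx hk
  obtain ⟨q, hq⟩ := h.pairing_int hx hl
  exact ⟨p + q, by rw [diagPairing_comm, diagPairing_add_right, hp, hq]; push_cast; rfl⟩

theorem zero_mem (h : IsDiagSelfDual a Λ) : (0 : Fin n → ℤ) ∈ Λ :=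
  (h.mem_iff _).mpr fun x _ ↦ ⟨0, by simp [diagPairing]⟩

theorem mul_mem (h : IsDiagSelfDual a Λ) (m : Fin n → ℤ) : (fun i ↦ (a i : ℤ) * m i) ∈ Λ :=
  (h.mem_iff _).mpr fun x _ ↦ ⟨∑ i, x i * m i, by
    rw [diagPairing_comm, diagPairing_mul_right h.pos]⟩

theorem add_mul_mem_iff (h : IsDiagSelfDual a Λ) (k m : Fin n → ℤ) :
    (fun i ↦ k i + a i * m i) ∈ Λ ↔ k ∈ Λ := by
  constructor
  · intro hk
    have := h.add_mem hk (h.mul_mem (-m))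
    convert this using 1
    ext i
    simp
  · exact fun hk ↦ h.add_mem hk (h.mul_mem m)

theorem emod_mem_iff (h : IsDiagSelfDual a Λ) (k : Fin n → ℤ) :
    (fun i ↦ k i % a i) ∈ Λ ↔ k ∈ Λ := by
  rw [← h.add_mul_mem_iff (fun i ↦ k i % a i) (fun i ↦ k i / a i)]
  simp only [Int.emod_add_mul_ediv]

theorem neg_mem (h : IsDiagSelfDual a Λ) {k : Fin n → ℤ} (hk : k ∈ Λ) : -k ∈ Λ := by
  refine (h.mem_iff _).mpr fun x hx ↦ ?_
  obtain ⟨p, hp⟩ := h.pairing_int hk hx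
  refine ⟨-p, ?_⟩
  push_cast
  rw [← hp, diagPairing, diagPairing, ← Finset.sum_neg_distrib]
  refine Finset.sum_congr rfl fun i _ ↦ ?_
  simp only [Pi.neg_apply]
  push_cast
  ring

open Classical in
/-- Representatives of `Λ` modulo the sublattice of coordinatewise multiples of `a`. -/
noncomputable def reps (a : Fin n → ℕ) (Λ : Set (Fin n → ℤ)) : Finset (Fin n → ℤ) :=
  (Fintype.piFinset fun i ↦ Finset.Ico (0 : ℤ) (a i)).filter (· ∈ Λ)

theorem mem_reps {c : Fin n → ℤ} :
    c ∈ reps a Λ ↔ (∀ i, 0 ≤ c i ∧ c i < a i) ∧ c ∈ Λ := by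
  simp [reps]

theorem emod_mem_reps (h : IsDiagSelfDual a Λ) {k : Fin n → ℤ} (hk : k ∈ Λ) :
    (fun i ↦ k i % a i) ∈ reps a Λ := by
  refine mem_reps.mpr ⟨fun i ↦ ?_, (h.emod_mem_iff k).mpr hk⟩
  have : (0 : ℤ) < a i := by exact_mod_cast h.pos i
  exact ⟨Int.emod_nonneg _ this.ne', Int.emod_lt_of_pos _ this⟩

theorem emod_of_mem_reps {c : Fin n → ℤ} (hc : c ∈ reps a Λ) (i : Fin n) : c i % a i = c i :=
  Int.emod_eq_of_lt ((mem_reps.mp hc).1 i).1 ((mem_reps.mp hc).1 i).2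

theorem zero_mem_reps (h : IsDiagSelfDual a Λ) : (0 : Fin n → ℤ) ∈ reps a Λ :=
  mem_reps.mpr ⟨fun i ↦ ⟨le_rfl, Nat.cast_pos.mpr (h.pos i)⟩, h.zero_mem⟩

theorem exp_two_pi_mul_intCast (m : ℤ) : cexp (2 * Real.pi * I * ((m : ℝ) : ℂ)) = 1 := by
  rw [ofReal_intCast, mul_comm]
  exact Complex.exp_int_mul_two_pi_mul_I m

theorem exp_pairing_emod (h : IsDiagSelfDual a Λ) (k l : Fin n → ℤ) :
    cexp (2 * Real.pi * I * diagPairing a k (fun i ↦ l i % a i)) =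
      cexp (2 * Real.pi * I * diagPairing a k l) := by
  have hl : l = (fun i ↦ l i % a i) + fun i ↦ (a i : ℤ) * (l i / a i) := by
    ext i
    simp [Int.emod_add_mul_ediv]
  conv_rhs => rw [hl]
  rw [diagPairing_add_right, diagPairing_mul_right h.pos, ofReal_add, mul_add, Complex.exp_add,
    exp_two_pi_mul_intCast, mul_one]

theorem sum_exp_pairing_of_mem (h : IsDiagSelfDual a Λ) {k : Fin n → ℤ} (hk : k ∈ Λ) :
    ∑ c ∈ reps a Λ, cexp (2 * Real.pi * I * diagPairing a k c) = (reps a Λ).card := by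
  rw [Finset.sum_congr rfl (g := fun _ ↦ (1 : ℂ))]
  · simp
  · intro c hc
    obtain ⟨m, hm⟩ := h.pairing_int hk (mem_reps.mp hc).2
    rw [hm, exp_two_pi_mul_intCast]

theorem sum_exp_pairing_of_notMem (h : IsDiagSelfDual a Λ) {k : Fin n → ℤ} (hk : k ∉ Λ) :
    ∑ c ∈ reps a Λ, cexp (2 * Real.pi * I * diagPairing a k c) = 0 := by
  have : ∃ l ∈ Λ, ¬ ∃ m : ℤ, diagPairing a k l = m := by
    by_contra! hc
    exact hk ((h.mem_iff k).mpr hc)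
  obtain ⟨l, hl, hne⟩ := this
  have hshift : ∑ c ∈ reps a Λ, cexp (2 * Real.pi * I * diagPairing a k (c + l)) =
      ∑ c ∈ reps a Λ, cexp (2 * Real.pi * I * diagPairing a k c) := by
    refine Finset.sum_bij' (fun c _ i ↦ (c + l) i % a i) (fun c _ i ↦ (c - l) i % a i)
      ?_ ?_ ?_ ?_ ?_
    · exact fun c hc ↦ h.emod_mem_reps (h.add_mem (mem_reps.mp hc).2 hl)
    · intro c hc
      rw [sub_eq_add_neg]
      exact h.emod_mem_reps (h.add_mem (mem_reps.mp hc).2 (h.neg_mem hl))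
    · intro c hc
      ext i
      simp [emod_of_mem_reps hc i]
    · intro c hc
      ext i
      simp [emod_of_mem_reps hc i]
    · intro c hc
      rw [h.exp_pairing_emod]
  simp only [diagPairing_add_right, ofReal_add, mul_add, Complex.exp_add] at hshift
  rw [← Finset.sum_mul] at hshift
  by_contra hs
  have h1 : cexp (2 * Real.pi * I * diagPairing a k l) = 1 := by
    exact mul_left_cancel₀ hs (by rw [hshift, mul_one])
  obtain ⟨m, hm⟩ := Complex.exp_eq_one_iff.mp h1
  refine hne ⟨m, ?_⟩
  have hpi : (2 * Real.pi * I : ℂ) ≠ 0 := Complex.two_pi_I_ne_zero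
  rw [mul_comm] at hm
  exact_mod_cast mul_right_cancel₀ hpi hm

/-- Division with remainder by `a` on `Λ`. -/
noncomputable def equivReps (h : IsDiagSelfDual a Λ) : reps a Λ × (Fin n → ℤ) ≃ Λ where
  toFun p := ⟨fun i ↦ p.1.1 i + a i * -p.2 i,
    (h.add_mul_mem_iff p.1.1 (-p.2)).mpr (mem_reps.mp p.1.2).2⟩
  invFun k := (⟨fun i ↦ k.1 i % a i, h.emod_mem_reps k.2⟩, fun i ↦ -(k.1 i / a i))
  left_inv := by
    rintro ⟨⟨c, hc⟩, m⟩
    have hne (i) : (a i : ℤ) ≠ 0 := by exact_mod_cast (h.pos i).ne'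
    ext i
    · simp [emod_of_mem_reps hc i]
    · have := Int.ediv_eq_zero_of_lt ((mem_reps.mp hc).1 i).1 ((mem_reps.mp hc).1 i).2
      simp only
      rw [Int.add_mul_ediv_left _ _ (hne i), this]
      simp
  right_inv := by
    rintro ⟨k, hk⟩
    ext i
    simp [Int.emod_add_mul_ediv]

end IsDiagSelfDual
end Theta

section Inversion
open Complex

variable {n : ℕ}

/-- The terms of the theta series of `diagPairing a` with elliptic variables `w`. -/
noncomputable def diagThetaTerm (a : Fin n → ℕ) (τ : ℂ) (w : Fin n → ℂ) (k : Fin n → ℤ) : ℂ :=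
  cexp (Real.pi * I * diagPairing a k k * τ + 2 * Real.pi * I * ∑ i, k i * w i)

theorem diagThetaTerm_eq_prod {a : Fin n → ℕ} (τ : ℂ) (w : Fin n → ℂ)
    (k : Fin n → ℤ) : diagThetaTerm a τ w k = ∏ i, jacobiTheta₂_term (k i) (w i) (τ / a i) := by
  simp only [jacobiTheta₂_term, ← Complex.exp_sum, diagThetaTerm, diagPairing]
  congr 1
  push_cast
  simp only [Finset.mul_sum, Finset.sum_mul, ← Finset.sum_add_distrib]
  refine Finset.sum_congr rfl fun i _ ↦ ?_
  ring

theorem diagThetaTerm_add_div (a : Fin n → ℕ) (τ : ℂ) (w : Fin n → ℂ) (k c : Fin n → ℤ) :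
    diagThetaTerm a τ (fun i ↦ w i + c i / a i) k =
      diagThetaTerm a τ w k * cexp (2 * Real.pi * I * diagPairing a k c) := by
  rw [diagThetaTerm, diagThetaTerm, ← Complex.exp_add]
  congr 1
  rw [diagPairing, diagPairing]
  push_cast
  simp only [mul_add, Finset.sum_add_distrib, mul_div_assoc]
  ring

/-- A uniform form of absolute convergence of theta series. -/
theorem summable_norm_exp_diagPairing {a : Fin n → ℕ} (ha : ∀ i, 0 < a i) {y : ℝ} (hy : 0 < y)
    (R : ℝ) : Summable fun k : Fin n → ℤ ↦
      Real.exp (-Real.pi * y * diagPairing a k k) * Real.exp (R * ∑ i, |(k i : ℝ)|) := by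
  have ha' (i) : (0 : ℝ) < a i := Nat.cast_pos.mpr (ha i)
  refine (summable_exp_sum_neg_sq_add (y := fun i ↦ Real.pi * y / a i)
    (fun i ↦ by have := ha' i; positivity) R).congr fun k ↦ ?_
  rw [← Real.exp_add, diagPairing]
  congr 1
  rw [Finset.mul_sum, Finset.mul_sum, ← Finset.sum_add_distrib]
  refine Finset.sum_congr rfl fun i _ ↦ ?_
  ring

theorem norm_diagThetaTerm_le (a : Fin n → ℕ) (τ : ℂ) (w : Fin n → ℂ) (k : Fin n → ℤ) :
    ‖diagThetaTerm a τ w k‖ ≤ Real.exp (-Real.pi * τ.im * diagPairing a k k) *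
      Real.exp (2 * Real.pi * (∑ i, ‖w i‖) * ∑ i, |(k i : ℝ)|) := by
  rw [diagThetaTerm, Complex.exp_add, norm_mul]
  gcongr
  · rw [Complex.norm_exp]
    apply le_of_eq
    congr 1
    simp
    ring
  · refine (norm_exp_le_exp_norm _).trans (Real.exp_le_exp.mpr ?_)
    rw [norm_mul, norm_mul, norm_mul, Complex.norm_I, Complex.norm_real, Complex.norm_ofNat,
      Real.norm_of_nonneg Real.pi_pos.le, mul_one, mul_assoc (2 * Real.pi)]
    gcongr
    rw [Finset.mul_sum]
    refine (norm_sum_le _ _).trans (Finset.sum_le_sum fun i _ ↦ ?_)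
    rw [norm_mul, Complex.norm_intCast, mul_comm]
    gcongr
    exact Finset.single_le_sum (f := fun i ↦ ‖w i‖) (fun _ _ ↦ norm_nonneg _) (Finset.mem_univ i)

theorem summable_diagThetaTerm {a : Fin n → ℕ} (ha : ∀ i, 0 < a i) {τ : ℂ} (hτ : 0 < τ.im)
    (w : Fin n → ℂ) : Summable (diagThetaTerm a τ w) :=
  Summable.of_norm_bounded (summable_norm_exp_diagPairing ha hτ _) (norm_diagThetaTerm_le a τ w)

theorem hasSum_diagThetaTerm {a : Fin n → ℕ} (ha : ∀ i, 0 < a i) {τ : ℂ} (hτ : 0 < τ.im)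
    (w : Fin n → ℂ) : HasSum (diagThetaTerm a τ w) (∏ i, jacobiTheta₂ (w i) (τ / a i)) := by
  have h := hasSum_pi_prod (fun i m ↦ jacobiTheta₂_term m (w i) (τ / a i)) fun i ↦ by
    rw [summable_jacobiTheta₂_term_iff, Complex.div_natCast_im]
    exact div_pos hτ (Nat.cast_pos.mpr (ha i))
  simpa only [← diagThetaTerm_eq_prod, jacobiTheta₂] using! h

/-- The theta series of `Λ` with elliptic variables `w`. -/
noncomputable def diagTheta (a : Fin n → ℕ) (Λ : Set (Fin n → ℤ)) (τ : ℂ) (w : Fin n → ℂ) : ℂ :=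
  ∑' k : Λ, diagThetaTerm a τ w k

theorem jacobiTheta₂_add_div_functional_equation {a : ℕ} (ha : 0 < a) {τ : ℂ} (hτ : 0 < τ.im)
    (w : ℂ) (c : ℤ) : jacobiTheta₂ (w + c / a) (τ / a) =
      1 / (-I * (τ / a)) ^ (1 / 2 : ℂ) * (cexp (-Real.pi * I * (a * w ^ 2) / τ) *
        ∑' m : ℤ, jacobiTheta₂_term (c + a * -m) (-w / τ) (-1 / τ / a)) := by
  have ha' : (a : ℂ) ≠ 0 := Nat.cast_ne_zero.mpr ha.ne'
  have hτ' : τ ≠ 0 := by rintro rfl; simp at hτ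
  rw [jacobiTheta₂_functional_equation, mul_assoc]
  congr 1
  rw [jacobiTheta₂, ← tsum_mul_left, ← tsum_mul_left]
  refine tsum_congr fun m ↦ ?_
  rw [jacobiTheta₂_term, jacobiTheta₂_term, ← Complex.exp_add, ← Complex.exp_add]
  congr 1
  push_cast
  field_simp
  ring

namespace IsDiagSelfDual
variable {a : Fin n → ℕ} {Λ : Set (Fin n → ℤ)}

theorem card_mul_diagTheta (h : IsDiagSelfDual a Λ) {τ : ℂ} (hτ : 0 < τ.im) (w : Fin n → ℂ) :
    (reps a Λ).card * diagTheta a Λ τ w =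
      ∑ c ∈ reps a Λ, ∏ i, jacobiTheta₂ (w i + c i / a i) (τ / a i) := by
  classical
  have h1 := hasSum_sum (s := reps a Λ) (fun c _ ↦
    hasSum_diagThetaTerm h.pos hτ (fun i ↦ w i + c i / a i))
  rw [← h1.tsum_eq, diagTheta, ← tsum_mul_left, tsum_subtype Λ
    (fun k ↦ ((reps a Λ).card : ℂ) * diagThetaTerm a τ w k)]
  refine tsum_congr fun k ↦ ?_
  simp only [diagThetaTerm_add_div, ← Finset.mul_sum]
  by_cases hk : k ∈ Λ
  · rw [Set.indicator_of_mem hk, h.sum_exp_pairing_of_mem hk, mul_comm]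
  · rw [Set.indicator_of_notMem hk, h.sum_exp_pairing_of_notMem hk, mul_zero]

theorem diagTheta_eq_sum_tsum (h : IsDiagSelfDual a Λ) {τ : ℂ} (hτ : 0 < τ.im) (w : Fin n → ℂ) :
    diagTheta a Λ τ w = ∑ c ∈ reps a Λ, ∏ i, ∑' m : ℤ,
      jacobiTheta₂_term (c i + a i * -m) (w i) (τ / a i) := by
  have hs : Summable fun p : reps a Λ × (Fin n → ℤ) ↦ diagThetaTerm a τ w (h.equivReps p) :=
    h.equivReps.summable_iff.mpr ((summable_diagThetaTerm h.pos hτ w).subtype Λ)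
  rw [diagTheta, ← h.equivReps.tsum_eq, hs.tsum_prod, tsum_fintype]
  rw [← Finset.sum_coe_sort (reps a Λ)]
  refine Finset.sum_congr rfl fun c _ ↦ ?_
  refine HasSum.tsum_eq ?_
  have h1 (i : Fin n) : Summable fun m : ℤ ↦
      jacobiTheta₂_term (c.1 i + a i * -m) (w i) (τ / a i) := by
    have h2 : Summable (jacobiTheta₂_term · (w i) (τ / a i)) := by
      rw [summable_jacobiTheta₂_term_iff, Complex.div_natCast_im]
      exact div_pos hτ (Nat.cast_pos.mpr (h.pos i))
    have hinj : Function.Injective fun m : ℤ ↦ c.1 i + a i * -m := fun x y hxy ↦ by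
      have hne : a i ≠ 0 := (h.pos i).ne'
      simpa [hne] using hxy
    exact h2.comp_injective hinj
  have h3 := hasSum_pi_prod
    (fun i m ↦ jacobiTheta₂_term (c.1 i + a i * -m) (w i) (τ / a i)) h1
  refine h3.congr_fun fun m ↦ ?_
  rw [diagThetaTerm_eq_prod]
  rfl

theorem card_mul_diagTheta_inversion (h : IsDiagSelfDual a Λ) {τ : ℂ} (hτ : 0 < τ.im)
    (w : Fin n → ℂ) : (reps a Λ).card * diagTheta a Λ τ w =
      (∏ i, 1 / (-I * (τ / a i)) ^ (1 / 2 : ℂ)) *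
        (cexp (-Real.pi * I * (∑ i, a i * w i ^ 2) / τ) *
          diagTheta a Λ (-1 / τ) (fun i ↦ -w i / τ)) := by
  have hτ2 : 0 < (-1 / τ).im := by
    rw [neg_div, one_div, Complex.neg_im, Complex.inv_im, neg_div, neg_neg]
    exact div_pos hτ (Complex.normSq_pos.mpr (by rintro rfl; simp at hτ))
  rw [h.card_mul_diagTheta hτ, h.diagTheta_eq_sum_tsum hτ2, Finset.mul_sum, Finset.mul_sum]
  refine Finset.sum_congr rfl fun c _ ↦ ?_
  simp only [Finset.mul_sum, Finset.sum_div, Complex.exp_sum, ← Finset.prod_mul_distrib]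
  exact Finset.prod_congr rfl fun i _ ↦ jacobiTheta₂_add_div_functional_equation (h.pos i) hτ _ _

end IsDiagSelfDual
end Inversion

section Moments
open Complex

theorem ofReal_mul_cpow {r : ℝ} (hr : 0 < r) {z : ℂ} (hz : z ≠ 0) (s : ℂ) :
    ((r : ℂ) * z) ^ s = (r : ℂ) ^ s * z ^ s := by
  have hr' : (r : ℂ) ≠ 0 := ofReal_ne_zero.mpr hr.ne'
  rw [cpow_def_of_ne_zero (mul_ne_zero hr' hz), cpow_def_of_ne_zero hr', cpow_def_of_ne_zero hz,
    log_ofReal_mul hr hz, ← Complex.exp_add, ofReal_log hr.le, add_mul]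

theorem deriv_deriv_exp_sq_mul {H H' : ℂ → ℂ} {H₂ : ℂ} (h1 : ∀ z, HasDerivAt H (H' z) z)
    (h2 : HasDerivAt H' H₂ 0) (p q : ℂ) :
    deriv (deriv fun z ↦ cexp (p * z ^ 2) * H (q * z)) 0 = 2 * p * H 0 + q ^ 2 * H₂ := by
  have e1 (z : ℂ) : HasDerivAt (fun z ↦ cexp (p * z ^ 2)) (cexp (p * z ^ 2) * (p * (2 * z))) z := by
    simpa using! ((hasDerivAt_pow 2 z).const_mul p).cexp
  have l1 (z : ℂ) : HasDerivAt (fun z ↦ q * z) q z := by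
    simpa using (hasDerivAt_id z).const_mul q
  have e2 (z : ℂ) : HasDerivAt (fun z ↦ H (q * z)) (H' (q * z) * q) z := (h1 (q * z)).comp z (l1 z)
  have e3 : HasDerivAt (fun z ↦ H' (q * z)) (H₂ * q) 0 :=
    HasDerivAt.comp (h₂ := H') 0 (by simpa using h2) (l1 0)
  have d1 : (deriv fun z ↦ cexp (p * z ^ 2) * H (q * z)) = fun z ↦
      cexp (p * z ^ 2) * (p * (2 * z)) * H (q * z) + cexp (p * z ^ 2) * (H' (q * z) * q) :=
    funext fun z ↦ ((e1 z).mul (e2 z)).deriv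
  have l2 : HasDerivAt (fun z : ℂ ↦ p * (2 * z)) (p * 2) 0 := by
    simpa using ((hasDerivAt_id (0 : ℂ)).const_mul 2).const_mul p
  have e4 : HasDerivAt (fun z ↦ cexp (p * z ^ 2) * (p * (2 * z)) * H (q * z) +
      cexp (p * z ^ 2) * (H' (q * z) * q)) _ 0 :=
    (((e1 0).mul l2).mul (e2 0)).add ((e1 0).mul (e3.mul_const q))
  rw [d1, e4.deriv]
  simp
  ring

theorem im_neg_one_div_pos {τ : ℂ} (hτ : 0 < τ.im) : 0 < (-1 / τ).im := by
  rw [neg_div, one_div, Complex.neg_im, Complex.inv_im, neg_div, neg_neg]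
  exact div_pos hτ (Complex.normSq_pos.mpr (by rintro rfl; simp at hτ))

namespace IsDiagSelfDual

theorem diagTheta_I_ne_zero {n : ℕ} {a : Fin n → ℕ} {Λ : Set (Fin n → ℤ)}
    (h : IsDiagSelfDual a Λ) : diagTheta a Λ I 0 ≠ 0 := by
  have hterm (k : Fin n → ℤ) :
      diagThetaTerm a I 0 k = ((Real.exp (-Real.pi * diagPairing a k k) : ℝ) : ℂ) := by
    rw [diagThetaTerm, ofReal_exp]
    congr 1
    push_cast
    simp only [Pi.zero_apply, mul_zero, Finset.sum_const_zero, add_zero]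
    linear_combination (Real.pi * diagPairing a k k : ℂ) * I_mul_I
  have hs := (summable_diagThetaTerm h.pos (τ := I) (by simp) 0).subtype Λ
  simp only [Function.comp_def, hterm] at hs
  rw [diagTheta]
  simp only [hterm, ← ofReal_tsum]
  rw [ofReal_ne_zero]
  exact ((Complex.summable_ofReal.mp hs).tsum_pos (fun _ ↦ (Real.exp_pos _).le)
    ⟨0, h.zero_mem⟩ (Real.exp_pos _)).ne'

variable {a : Fin 24 → ℕ} {Λ : Set (Fin 24 → ℤ)}

theorem exists_diagTheta_inversion (h : IsDiagSelfDual a Λ) : ∃ κ : ℂ, ∀ τ : ℂ, 0 < τ.im →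
    ∀ w : Fin 24 → ℂ, τ ^ 12 * diagTheta a Λ τ w =
      κ * (cexp (-Real.pi * I * (∑ i, a i * w i ^ 2) / τ) *
        diagTheta a Λ (-1 / τ) (fun i ↦ -w i / τ)) := by
  refine ⟨(∏ i, 1 / (((a i : ℝ)⁻¹ : ℝ) : ℂ) ^ (1 / 2 : ℂ)) / (reps a Λ).card, fun τ hτ w ↦ ?_⟩
  have hτ' : τ ≠ 0 := by rintro rfl; simp at hτ
  have hIτ : -I * τ ≠ 0 := mul_ne_zero (neg_ne_zero.mpr I_ne_zero) hτ'
  have hcard : ((reps a Λ).card : ℂ) ≠ 0 :=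
    Nat.cast_ne_zero.mpr (Finset.card_ne_zero_of_mem h.zero_mem_reps)
  have hfac (i : Fin 24) : 1 / (-I * (τ / a i)) ^ (1 / 2 : ℂ) =
      1 / (((a i : ℝ)⁻¹ : ℝ) : ℂ) ^ (1 / 2 : ℂ) * (1 / (-I * τ) ^ (1 / 2 : ℂ)) := by
    rw [div_mul_div_comm, one_mul,
      ← ofReal_mul_cpow (inv_pos.mpr (Nat.cast_pos.mpr (h.pos i))) hIτ]
    congr 2
    push_cast
    ring
  have hpow : ((-I * τ) ^ (1 / 2 : ℂ)) ^ 24 = τ ^ 12 := by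
    rw [← cpow_nat_mul]
    norm_num
    rw [mul_pow, show I ^ 12 = (I ^ 4) ^ 3 by ring, I_pow_four, one_pow, one_mul]
  have hmain := h.card_mul_diagTheta_inversion hτ w
  simp only [hfac, Finset.prod_mul_distrib, Finset.prod_const, Finset.card_univ,
    Fintype.card_fin] at hmain
  rw [div_pow, one_pow, hpow] at hmain
  field_simp at hmain ⊢
  linear_combination hmain

theorem diagTheta_inversion (h : IsDiagSelfDual a Λ) {τ : ℂ} (hτ : 0 < τ.im)
    (w : Fin 24 → ℂ) : τ ^ 12 * diagTheta a Λ τ w =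
      cexp (-Real.pi * I * (∑ i, a i * w i ^ 2) / τ) *
        diagTheta a Λ (-1 / τ) (fun i ↦ -w i / τ) := by
  obtain ⟨κ, hκ⟩ := h.exists_diagTheta_inversion
  have h1 := hκ I (by simp) 0
  have hI : -1 / I = I := by rw [div_I]; ring
  have hw : (fun i ↦ -(0 : Fin 24 → ℂ) i / I) = 0 := by ext; simp
  rw [hI, hw, show I ^ 12 = (I ^ 4) ^ 3 by ring, I_pow_four] at h1
  have : κ = 1 := by
    refine mul_right_cancel₀ h.diagTheta_I_ne_zero ?_
    simpa using h1.symm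
  rw [hκ τ hτ w, this, one_mul]

end IsDiagSelfDual

/-- The theta series of `Λ` weighted by `(∑ kᵢ bᵢ)²`. -/
noncomputable def diagThetaSq {n : ℕ} (a : Fin n → ℕ) (Λ : Set (Fin n → ℤ)) (b : Fin n → ℂ)
    (τ : ℂ) : ℂ :=
  ∑' k : Λ, diagThetaTerm a τ 0 k * (∑ i, k.1 i * b i) ^ 2

section
variable {n : ℕ} {a : Fin n → ℕ} {Λ : Set (Fin n → ℤ)}

theorem norm_diagThetaTerm_zero (a : Fin n → ℕ) (τ : ℂ) (k : Fin n → ℤ) :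
    ‖diagThetaTerm a τ 0 k‖ = Real.exp (-Real.pi * τ.im * diagPairing a k k) := by
  rw [diagThetaTerm, Complex.norm_exp]
  congr 1
  simp
  ring

theorem norm_sum_intCast_mul_le (b : Fin n → ℂ) (k : Fin n → ℤ) :
    ‖∑ i, k i * b i‖ ≤ (∑ i, ‖b i‖) * ∑ i, |(k i : ℝ)| := by
  rw [Finset.mul_sum]
  refine (norm_sum_le _ _).trans (Finset.sum_le_sum fun i _ ↦ ?_)
  rw [norm_mul, Complex.norm_intCast, mul_comm]
  gcongr
  exact Finset.single_le_sum (f := fun i ↦ ‖b i‖) (fun _ _ ↦ norm_nonneg _) (Finset.mem_univ i)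

theorem summable_norm_diagThetaTerm_zero_mul_exp (ha : ∀ i, 0 < a i) {τ : ℂ} (hτ : 0 < τ.im)
    (b : Fin n → ℂ) (R : ℝ) : Summable fun k : Fin n → ℤ ↦ ‖diagThetaTerm a τ 0 k‖ *
      Real.exp (R * ‖2 * Real.pi * I * ∑ i, k i * b i‖) := by
  refine Summable.of_nonneg_of_le (fun k ↦ by positivity) (fun k ↦ ?_)
    (summable_norm_exp_diagPairing ha hτ (|R| * (2 * Real.pi * ∑ i, ‖b i‖)))
  rw [norm_diagThetaTerm_zero, mul_assoc |R|]
  gcongr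
  · exact le_abs_self R
  · rw [norm_mul, norm_mul, norm_mul, Complex.norm_I, Complex.norm_real, Complex.norm_ofNat,
      Real.norm_of_nonneg Real.pi_pos.le, mul_one, mul_assoc (2 * Real.pi)]
    gcongr
    exact norm_sum_intCast_mul_le b k

theorem diagTheta_mul_eq (τ : ℂ) (b : Fin n → ℂ) (z : ℂ) :
    diagTheta a Λ τ (fun i ↦ z * b i) =
      ∑' k : Λ, diagThetaTerm a τ 0 k * cexp ((2 * Real.pi * I * ∑ i, k.1 i * b i) * z) := by
  refine tsum_congr fun k ↦ ?_
  rw [diagThetaTerm, diagThetaTerm, ← Complex.exp_add]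
  congr 1
  simp only [Pi.zero_apply, mul_zero, Finset.sum_const_zero, add_zero]
  rw [mul_assoc (2 * Real.pi * I) (∑ i, _), Finset.sum_mul]
  simp only [mul_comm z, mul_assoc]

theorem tsum_mul_two_pi_I_sq (τ : ℂ) (b : Fin n → ℂ) :
    ∑' k : Λ, diagThetaTerm a τ 0 k * (2 * Real.pi * I * ∑ i, k.1 i * b i) ^ 2 =
      -(4 * Real.pi ^ 2) * diagThetaSq a Λ b τ := by
  rw [diagThetaSq, ← tsum_mul_left]
  refine tsum_congr fun k ↦ ?_
  linear_combination (4 * Real.pi ^ 2 * diagThetaTerm a τ 0 k * (∑ i, k.1 i * b i) ^ 2) * I_sq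

end

theorem IsDiagSelfDual.diagThetaSq_inversion {a : Fin 24 → ℕ} {Λ : Set (Fin 24 → ℤ)}
    (h : IsDiagSelfDual a Λ) {τ : ℂ} (hτ : 0 < τ.im) (b : Fin 24 → ℂ) :
    diagThetaSq a Λ b (-1 / τ) = τ ^ 14 * diagThetaSq a Λ b τ -
      (I * τ / (2 * Real.pi) * diagTheta a Λ (-1 / τ) 0) * ∑ i, a i * b i ^ 2 := by
  have hτ' : τ ≠ 0 := by rintro rfl; simp at hτ
  have hs1 (R : ℝ) : Summable fun k : Λ ↦ ‖diagThetaTerm a τ 0 k‖ *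
      Real.exp (R * ‖2 * Real.pi * I * ∑ i, k.1 i * b i‖) :=
     (summable_norm_diagThetaTerm_zero_mul_exp h.pos hτ b R).subtype Λ
  have hs2 (R : ℝ) : Summable fun k : Λ ↦ ‖diagThetaTerm a (-1 / τ) 0 k‖ *
      Real.exp (R * ‖2 * Real.pi * I * ∑ i, k.1 i * b i‖) :=
     (summable_norm_diagThetaTerm_zero_mul_exp h.pos
    (im_neg_one_div_pos hτ) b R).subtype Λ
  have hfun : (fun z : ℂ ↦ τ ^ 12 * ∑' k : Λ, diagThetaTerm a τ 0 k *
      cexp ((2 * Real.pi * I * ∑ i, k.1 i * b i) * z)) = fun z ↦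
      cexp ((-Real.pi * I * (∑ i, a i * b i ^ 2) / τ) * z ^ 2) *
        ∑' k : Λ, diagThetaTerm a (-1 / τ) 0 k *
          cexp ((2 * Real.pi * I * ∑ i, k.1 i * b i) * (-1 / τ * z)) := by
    ext z
    rw [← diagTheta_mul_eq, ← diagTheta_mul_eq, h.diagTheta_inversion hτ]
    congr 2
    · rw [div_mul_eq_mul_div, mul_assoc (-Real.pi * I : ℂ), Finset.sum_mul]
      simp only [mul_pow, mul_comm (z ^ 2), mul_assoc]
    · ext i
      ring
  have hd := congrArg (fun f : ℂ → ℂ ↦ deriv (deriv f) 0) hfun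
  have hc (c : ℂ) (g : ℂ → ℂ) : deriv (fun z ↦ c * g z) = fun z ↦ c * deriv g z :=
    funext fun z ↦ deriv_const_mul_field c
  beta_reduce at hd
  rw [hc, hc] at hd
  beta_reduce at hd
  rw [deriv_deriv_tsum_mul_exp hs1, tsum_mul_two_pi_I_sq, deriv_deriv_exp_sq_mul
    (fun z ↦ hasDerivAt_tsum_mul_exp hs2 z)
    (hasDerivAt_tsum_mul_exp (summable_exp_weight_mul hs2) 0)] at hd
  have h0 := diagTheta_mul_eq (a := a) (Λ := Λ) (-1 / τ) b 0
  simp only [zero_mul] at h0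
  have h2 := tsum_mul_two_pi_I_sq (a := a) (Λ := Λ) (-1 / τ) b
  have h3 : ∑' k : Λ, diagThetaTerm a (-1 / τ) 0 k * (2 * Real.pi * I * ∑ i, k.1 i * b i) *
      (2 * Real.pi * I * ∑ i, k.1 i * b i) * cexp ((2 * Real.pi * I * ∑ i, k.1 i * b i) * 0) =
      -(4 * Real.pi ^ 2) * diagThetaSq a Λ b (-1 / τ) := by
    rw [← h2]
    refine tsum_congr fun k ↦ ?_
    rw [mul_zero, Complex.exp_zero]
    ring
  rw [h3, ← h0] at hd
  change _ = 2 * _ * diagTheta a Λ (-1 / τ) 0 + _ at hd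
  have hpi : (Real.pi : ℂ) ≠ 0 := ofReal_ne_zero.mpr Real.pi_ne_zero
  field_simp at hd ⊢
  linear_combination (1 / 2) * hd

end Moments

section WeightFourteen
open UpperHalfPlane ModularForm SlashInvariantForm MatrixGroups Filter Topology

/-- A function on `ℂ` that transforms like a cusp form of weight 14 and level one vanishes on the
upper half plane. -/
theorem eqOn_zero_of_weight_fourteen (G : ℂ → ℂ)
    (hol : DifferentiableOn ℂ G {z | 0 < z.im})
    (hT : ∀ z : ℂ, 0 < z.im → G (z + 1) = G z)
    (hS : ∀ z : ℂ, 0 < z.im → G (-1 / z) = z ^ 14 * G z)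
    (h0 : Tendsto (fun τ : ℍ ↦ G τ) atImInfty (𝓝 0)) (τ : ℍ) : G τ = 0 := by
  have S_inv : ((fun τ : ℍ ↦ G τ) ∣[(14 : ℤ)] ModularGroup.S) = fun τ : ℍ ↦ G τ := by
    ext z
    rw [SL_slash_apply, UpperHalfPlane.modular_S_smul]
    have h := hS z z.im_pos
    rw [neg_div, one_div] at h
    have hd : denom (ModularGroup.S : GL (Fin 2) ℝ) z = z := ModularGroup.denom_S z
    have hz : (z : ℂ) ≠ 0 := z.ne_zero
    rw [hd]
    change G (-(z : ℂ))⁻¹ * _ = _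
    rw [inv_neg, h, zpow_neg]
    norm_cast
    field_simp
  have T_inv : ((fun τ : ℍ ↦ G τ) ∣[(14 : ℤ)] ModularGroup.T) = fun τ : ℍ ↦ G τ := by
    ext z
    rw [SL_slash_apply, modular_T_smul]
    have hd : denom (ModularGroup.T : GL (Fin 2) ℝ) z = 1 := by
      simp [denom, Matrix.SpecialLinearGroup.map_apply_coe, ModularGroup.coe_T]
    rw [hd, one_zpow, mul_one, UpperHalfPlane.coe_vadd, Complex.ofReal_one, add_comm]
    exact hT z z.im_pos
  let f : CuspForm 𝒮ℒ 14 :=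
    { toFun := fun τ ↦ G τ
      slash_action_eq' := by
        rintro _ ⟨A, rfl⟩
        exact slash_action_generators_SL2Z S_inv T_inv A
      holo' := by
        rw [UpperHalfPlane.mdifferentiable_iff]
        refine hol.congr fun z hz ↦ ?_
        simp [ofComplex_apply_of_im_pos hz]
      zero_at_cusps' := by
        intro c hc
        rw [Subgroup.IsArithmetic.isCusp_iff_isCusp_SL2Z] at hc
        rw [OnePoint.isZeroAt_iff_forall_SL2Z hc]
        intro γ _
        rw [slash_action_generators_SL2Z S_inv T_inv]
        exact h0 }
  have h2 : CuspForm.discriminantEquiv f = 0 :=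
    rank_zero_iff_forall_zero.mp ModularForm.levelOne_weight_two_rank_zero _
  have hf : f = 0 := CuspForm.discriminantEquiv.map_eq_zero_iff.mp h2
  exact DFunLike.congr_fun hf τ

end WeightFourteen

section CuspSeries
open Complex
open UpperHalfPlane hiding I
open Filter Topology

variable {ι : Type*} {m : ι → ℕ} {p : ι → ℂ}

theorem norm_mul_exp_two_pi_I_mul (p : ℂ) (m : ℕ) (τ : ℂ) :
    ‖p * cexp (2 * Real.pi * I * m * τ)‖ = ‖p‖ * Real.exp (-2 * Real.pi * τ.im * m) := by
  rw [norm_mul, Complex.norm_exp]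
  congr 2
  simp
  ring

theorem differentiableOn_tsum_mul_exp_two_pi_I
    (hs : ∀ y : ℝ, 0 < y → Summable fun k ↦ ‖p k‖ * Real.exp (-2 * Real.pi * y * m k)) :
    DifferentiableOn ℂ (fun τ ↦ ∑' k, p k * cexp (2 * Real.pi * I * m k * τ)) {z | 0 < z.im} := by
  intro τ (hτ : 0 < τ.im)
  have hopen : IsOpen {z : ℂ | τ.im / 2 < z.im} := isOpen_lt continuous_const continuous_im
  have h := differentiableOn_tsum_of_summable_norm (hs (τ.im / 2) (half_pos hτ))
    (F := fun k (τ : ℂ) ↦ p k * cexp (2 * Real.pi * I * m k * τ))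
    (fun k ↦ by fun_prop) hopen fun k z (hz : τ.im / 2 < z.im) ↦ by
      rw [norm_mul_exp_two_pi_I_mul]
      gcongr ‖p k‖ * Real.exp ?_
      have : 0 ≤ Real.pi * m k := by positivity
      nlinarith
  exact (h.differentiableAt (hopen.mem_nhds (half_lt_self hτ))).differentiableWithinAt

theorem norm_tsum_mul_exp_two_pi_I_le
    (hs : ∀ y : ℝ, 0 < y → Summable fun k ↦ ‖p k‖ * Real.exp (-2 * Real.pi * y * m k))
    (h0 : ∀ k, m k = 0 → p k = 0) {τ : ℂ} (hτ : 1 ≤ τ.im) :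
    ‖∑' k, p k * cexp (2 * Real.pi * I * m k * τ)‖ ≤
      (∑' k, ‖p k‖ * Real.exp (-2 * Real.pi * 1 * m k)) *
        Real.exp (-(2 * Real.pi * (τ.im - 1))) := by
  refine tsum_of_norm_bounded ((hs 1 one_pos).hasSum.mul_right _) fun k ↦ ?_
  rw [norm_mul_exp_two_pi_I_mul]
  obtain hk | hk := Nat.eq_zero_or_pos (m k)
  · simp [h0 k hk]
  · rw [mul_assoc ‖p k‖, ← Real.exp_add]
    gcongr
    have h1 : (1 : ℝ) ≤ m k := by exact_mod_cast hk
    nlinarith [mul_nonneg Real.pi_pos.le (mul_nonneg (sub_nonneg.mpr hτ) (sub_nonneg.mpr h1))]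

theorem tendsto_tsum_mul_exp_two_pi_I_atImInfty
    (hs : ∀ y : ℝ, 0 < y → Summable fun k ↦ ‖p k‖ * Real.exp (-2 * Real.pi * y * m k))
    (h0 : ∀ k, m k = 0 → p k = 0) :
    Tendsto (fun τ : ℍ ↦ ∑' k, p k * cexp (2 * Real.pi * I * m k * τ)) atImInfty (𝓝 0) := by
  have him : Tendsto UpperHalfPlane.im atImInfty atTop := tendsto_comap
  have hlim : Tendsto (fun y : ℝ ↦ (∑' k, ‖p k‖ * Real.exp (-2 * Real.pi * 1 * m k)) *
      Real.exp (-(2 * Real.pi * (y - 1)))) atTop (𝓝 0) := by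
    rw [← mul_zero (∑' k, ‖p k‖ * Real.exp (-2 * Real.pi * 1 * m k))]
    refine (Real.tendsto_exp_neg_atTop_nhds_zero.comp ?_).const_mul _
    exact (tendsto_atTop_add_const_right _ (-1) tendsto_id).const_mul_atTop Real.two_pi_pos
  refine squeeze_zero_norm' ?_ (hlim.comp him)
  filter_upwards [him.eventually_ge_atTop 1] with τ hτ
  exact norm_tsum_mul_exp_two_pi_I_le hs h0 hτ

/-- If a `q`-series without constant term vanishes identically, so does its first coefficient. -/
theorem tsum_ite_eq_one_eq_zero
    (hs : ∀ y : ℝ, 0 < y → Summable fun k ↦ ‖p k‖ * Real.exp (-2 * Real.pi * y * m k))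
    (h0 : ∀ k, m k = 0 → p k = 0)
    (hF : ∀ τ : ℍ, ∑' k, p k * cexp (2 * Real.pi * I * m k * τ) = 0) :
    ∑' k, (if m k = 1 then p k else 0) = 0 := by
  have hlim : Tendsto (fun y : ℝ ↦ ∑' k, p k * (Real.exp (-(2 * Real.pi * y * (m k - 1))) : ℂ))
      atTop (𝓝 (∑' k, (if m k = 1 then p k else 0))) := by
    refine tendsto_tsum_of_dominated_convergence
      ((hs 1 one_pos).mul_right (Real.exp (2 * Real.pi))) (fun k ↦ ?_) ?_
    · obtain hk | hk | hk : m k = 0 ∨ m k = 1 ∨ 1 < m k := by omega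
      · simp [h0 k hk]
      · simp [hk]
      · rw [if_neg hk.ne', ← mul_zero (p k)]
        refine Tendsto.const_mul _ ?_
        have h1 : (0 : ℝ) < m k - 1 := sub_pos.mpr (by exact_mod_cast hk)
        have := Real.tendsto_exp_neg_atTop_nhds_zero.comp
          ((tendsto_id.const_mul_atTop Real.two_pi_pos).atTop_mul_const h1)
        exact_mod_cast (Complex.continuous_ofReal.tendsto 0).comp this
    · filter_upwards [eventually_ge_atTop 1] with y hy k
      rw [norm_mul, Complex.norm_real, Real.norm_of_nonneg (Real.exp_pos _).le]
      obtain hk | hk := Nat.eq_zero_or_pos (m k)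
      · simp [h0 k hk]
      · rw [mul_assoc ‖p k‖, ← Real.exp_add]
        gcongr
        have h1 : (1 : ℝ) ≤ m k := by exact_mod_cast hk
        nlinarith [mul_nonneg Real.pi_pos.le (mul_nonneg (sub_nonneg.mpr hy) (sub_nonneg.mpr h1))]
  refine tendsto_nhds_unique hlim (tendsto_const_nhds.congr' ?_)
  filter_upwards [eventually_gt_atTop 0] with y hy
  have h := hF ⟨I * y, by simpa⟩
  have h2 := congrArg (· * cexp (2 * Real.pi * y)) h
  simp only [zero_mul, ← tsum_mul_right] at h2
  rw [← h2]
  refine tsum_congr fun k ↦ ?_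
  rw [mul_assoc, ← Complex.exp_add, ofReal_exp]
  congr 2
  push_cast
  linear_combination (2 * Real.pi * m k * y : ℂ) * I_sq

theorem tsum_ite_eq_one_eq_zero_of_weight_fourteen
    (hs : ∀ y : ℝ, 0 < y → Summable fun k ↦ ‖p k‖ * Real.exp (-2 * Real.pi * y * m k))
    (h0 : ∀ k, m k = 0 → p k = 0)
    (hS : ∀ τ : ℂ, 0 < τ.im → ∑' k, p k * cexp (2 * Real.pi * I * m k * (-1 / τ)) =
      τ ^ 14 * ∑' k, p k * cexp (2 * Real.pi * I * m k * τ)) :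
    ∑' k, (if m k = 1 then p k else 0) = 0 := by
  refine tsum_ite_eq_one_eq_zero hs h0 (eqOn_zero_of_weight_fourteen
    (fun τ ↦ ∑' k, p k * cexp (2 * Real.pi * I * m k * τ))
    (differentiableOn_tsum_mul_exp_two_pi_I hs) (fun z _ ↦ tsum_congr fun k ↦ ?_) hS
    (tendsto_tsum_mul_exp_two_pi_I_atImInfty hs h0))
  congr 1
  rw [mul_add, mul_one, Complex.exp_add, mul_comm (2 * Real.pi * I) (m k : ℂ),
    Complex.exp_nat_mul_two_pi_mul_I, mul_one]

end CuspSeries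

section Design
open Complex

variable {n : ℕ} {a : Fin n → ℕ} {Λ : Set (Fin n → ℤ)}

theorem summable_diagThetaTerm_zero_mul_sq (ha : ∀ i, 0 < a i) {τ : ℂ} (hτ : 0 < τ.im)
    (b : Fin n → ℂ) :
    Summable fun k : Λ ↦ diagThetaTerm a τ 0 k * (∑ i, k.1 i * b i) ^ 2 := by
  have h := summable_exp_weight_mul (summable_exp_weight_mul
    (summable_norm_diagThetaTerm_zero_mul_exp ha hτ b)) 0
  simp only [zero_mul, Real.exp_zero, mul_one] at h
  have h2 := (h.of_norm.mul_left (-(4 * Real.pi ^ 2 : ℂ)⁻¹)).subtype Λ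
  refine h2.congr fun k ↦ ?_
  have hpi : (Real.pi : ℂ) ≠ 0 := ofReal_ne_zero.mpr Real.pi_ne_zero
  rw [Function.comp_apply]
  field_simp
  linear_combination (-4 * (∑ i, k.1 i * b i) ^ 2 * diagThetaTerm a τ 0 k.1) * I_sq

theorem diagPairing_self_eq_sum_sq (a : Fin n → ℕ) (k : Fin n → ℤ) :
    (diagPairing a k k : ℂ) = ∑ j, (∑ i, k i * (Pi.single j 1 : Fin n → ℂ) i) ^ 2 / a j := by
  rw [diagPairing]
  push_cast
  refine Finset.sum_congr rfl fun j _ ↦ ?_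
  simp [Pi.single_apply, sq]

theorem finite_setOf_diagPairing_self_eq (ha : ∀ i, 0 < a i) (c : ℝ) :
    {k : Fin n → ℤ | diagPairing a k k = c}.Finite := by
  have h := (summable_norm_exp_diagPairing ha one_pos 0).tendsto_cofinite_zero
  have h2 := h.eventually (gt_mem_nhds (Real.exp_pos (-Real.pi * 1 * c)))
  refine (Filter.eventually_cofinite.mp h2).subset fun k (hk : _ = c) ↦ ?_
  simp [hk]

namespace IsDiagSelfDual

theorem sum_sq_of_pairing_self_eq_two {a : Fin 24 → ℕ} {Λ : Set (Fin 24 → ℤ)}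
    (h : IsDiagSelfDual a Λ) (heven : ∀ k ∈ Λ, ∃ m : ℤ, diagPairing a k k = 2 * m)
    (b : Fin 24 → ℂ) (S : Finset (Fin 24 → ℤ))
    (hS : ∀ k, k ∈ S ↔ k ∈ Λ ∧ diagPairing a k k = 2) :
    ∑ k ∈ S, (∑ i, k i * b i) ^ 2 = S.card * (∑ i, a i * b i ^ 2) / 12 := by
  have hm (k : Λ) : ∃ m : ℕ, diagPairing a k k = 2 * m := by
    obtain ⟨m, hm⟩ := heven k k.2
    have : (0 : ℝ) ≤ m := by linarith [diagPairing_self_nonneg a k]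
    lift m to ℕ using by exact_mod_cast this
    exact ⟨m, mod_cast hm⟩
  choose m hm using hm
  have hterm (τ : ℂ) (k : Λ) : diagThetaTerm a τ 0 k = cexp (2 * Real.pi * I * m k * τ) := by
    rw [diagThetaTerm, hm]
    congr 1
    push_cast
    simp only [Pi.zero_apply, mul_zero, Finset.sum_const_zero, add_zero]
    ring
  let p (k : Λ) : ℂ := (∑ i, k.1 i * b i) ^ 2 - (∑ i, a i * b i ^ 2) / 24 *
    ∑ j, (∑ i, k.1 i * (Pi.single j 1 : Fin 24 → ℂ) i) ^ 2 / a j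
  have hp (k : Λ) : p k = (∑ i, k.1 i * b i) ^ 2 - (∑ i, a i * b i ^ 2) / 12 * m k := by
    simp only [p, ← diagPairing_self_eq_sum_sq, hm]
    push_cast
    ring
  have hsum {τ : ℂ} (hτ : 0 < τ.im) :
      HasSum (fun k ↦ p k * cexp (2 * Real.pi * I * m k * τ))
        (diagThetaSq a Λ b τ - (∑ i, a i * b i ^ 2) / 24 *
          ∑ j, diagThetaSq a Λ (Pi.single j 1) τ / a j) := by
    have h1 (b : Fin 24 → ℂ) := (summable_diagThetaTerm_zero_mul_sq (Λ := Λ) h.pos hτ b).hasSum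
    refine ((h1 b).sub ((hasSum_sum fun j (_ : j ∈ Finset.univ) ↦
      (h1 (Pi.single j 1)).div_const (a j : ℂ)).mul_left _)).congr_fun ?_
    intro k
    simp only [hterm, p, sub_mul, mul_assoc, Finset.sum_mul, div_mul_eq_mul_div, mul_comm (cexp _)]
  have hs (y : ℝ) (hy : 0 < y) : Summable fun k ↦ ‖p k‖ * Real.exp (-2 * Real.pi * y * m k) := by
    have := (hsum (τ := I * y) (by simpa)).summable.norm
    simpa only [norm_mul_exp_two_pi_I_mul, I_mul_im, ofReal_re] using this
  have h0 (k : Λ) (hk : m k = 0) : p k = 0 := by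
    have hk' : k.1 = 0 := by
      have h2 := hm k
      rw [hk, diagPairing, Nat.cast_zero, mul_zero, Finset.sum_eq_zero_iff_of_nonneg
        fun _ _ ↦ div_nonneg (mul_self_nonneg _) (Nat.cast_nonneg _)] at h2
      ext i
      simpa [(h.pos i).ne'] using h2 i (Finset.mem_univ i)
    simp [p, hk']
  have hmod (τ : ℂ) (hτ : 0 < τ.im) : ∑' k, p k * cexp (2 * Real.pi * I * m k * (-1 / τ)) =
      τ ^ 14 * ∑' k, p k * cexp (2 * Real.pi * I * m k * τ) := by
    rw [(hsum hτ).tsum_eq, (hsum (im_neg_one_div_pos hτ)).tsum_eq]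
    simp only [h.diagThetaSq_inversion hτ]
    have h1 (j : Fin 24) : ∑ i, (a i : ℂ) * (Pi.single j 1 : Fin 24 → ℂ) i ^ 2 = a j := by
      simp [Pi.single_apply]
    have h2 (j : Fin 24) : (a j : ℂ) ≠ 0 := Nat.cast_ne_zero.mpr (h.pos j).ne'
    simp only [h1, sub_div, Finset.sum_sub_distrib, mul_div_assoc, div_self (h2 _), mul_one,
      Finset.sum_const, Finset.card_univ, Fintype.card_fin, nsmul_eq_mul, ← Finset.mul_sum]
    push_cast
    ring
  have hmain := tsum_ite_eq_one_eq_zero_of_weight_fourteen hs h0 hmod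
  have hmem (k : Λ) : m k = 1 ↔ k.1 ∈ S := by
    rw [hS, hm]
    constructor
    · intro hk
      exact ⟨k.2, by simp [hk]⟩
    · intro hk
      have := hk.2
      exact_mod_cast (by linarith : (m k : ℝ) = 1)
  have hq : ∑' k : Λ, (if m k = 1 then p k else 0) = ∑' k : Λ, (S : Set (Fin 24 → ℤ)).indicator
      (fun k ↦ (∑ i, k i * b i) ^ 2 - (∑ i, a i * b i ^ 2) / 12) k := by
    refine tsum_congr fun k ↦ ?_
    rw [Set.indicator_apply]
    by_cases hk : m k = 1
    · rw [if_pos hk, if_pos (Finset.mem_coe.mpr ((hmem k).mp hk)), hp, hk, Nat.cast_one, mul_one]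
    · rw [if_neg hk, if_neg (mt (fun hk ↦ (hmem k).mpr (Finset.mem_coe.mp hk)) hk)]
  rw [hq, tsum_subtype Λ ((S : Set (Fin 24 → ℤ)).indicator _), Set.indicator_indicator,
    Set.inter_eq_right.mpr fun k hk ↦ ((hS k).mp hk).1, ← tsum_subtype,
    Finset.tsum_subtype' S (fun k ↦ (∑ i, k i * b i) ^ 2 - (∑ i, a i * b i ^ 2) / 12),
    Finset.sum_sub_distrib, Finset.sum_const, nsmul_eq_mul, sub_eq_zero] at hmain
  rw [hmain, mul_div_assoc]

end IsDiagSelfDual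
end Design

section Lattice
open Module

variable {V : Type*} [AddCommGroup V] [Module ℚ V] {L : Submodule ℤ V}

theorem exists_natCast_smul_mem_of_mem_span {v : V}
    (hv : v ∈ Submodule.span ℚ (L : Set V)) : ∃ n : ℕ, n ≠ 0 ∧ (n : ℚ) • v ∈ L := by
  induction hv using Submodule.span_induction with
  | mem x hx => exact ⟨1, one_ne_zero, by simpa using hx⟩
  | zero => exact ⟨1, one_ne_zero, by simp⟩
  | add x y _ _ hx hy =>
    obtain ⟨m, hm, hx⟩ := hx
    obtain ⟨n, hn, hy⟩ := hy
    refine ⟨m * n, mul_ne_zero hm hn, ?_⟩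
    have h : ((m * n : ℕ) : ℚ) • (x + y) = (n : ℤ) • ((m : ℚ) • x) + (m : ℤ) • ((n : ℚ) • y) := by
      rw [← Int.cast_smul_eq_zsmul ℚ, ← Int.cast_smul_eq_zsmul ℚ]
      push_cast
      module
    rw [h]
    exact L.add_mem (L.smul_mem _ hx) (L.smul_mem _ hy)
  | smul q x _ hx =>
    obtain ⟨m, hm, hx⟩ := hx
    refine ⟨m * q.den, mul_ne_zero hm q.den_ne_zero, ?_⟩
    have h : ((m * q.den : ℕ) : ℚ) • (q • x) = q.num • ((m : ℚ) • x) := by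
      rw [← Int.cast_smul_eq_zsmul ℚ, smul_smul, smul_smul]
      congr 1
      push_cast
      rw [mul_assoc, Rat.den_mul_eq_num, mul_comm]
    rw [h]
    exact L.smul_mem _ hx

variable {B : V →ₗ[ℚ] V →ₗ[ℚ] ℚ}

theorem exists_orthogonal_basis_mem_lattice {n : ℕ} (hn : 0 < n)
    (hspan : Submodule.span ℚ (L : Set V) = ⊤) (hrank : finrank ℚ V = n)
    (hsymm : ∀ x y : V, B x y = B y x) (hint : ∀ x ∈ L, ∀ y ∈ L, ∃ n : ℤ, B x y = (n : ℚ))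
    (hpos : ∀ x ∈ L, x ≠ 0 → 0 < B x x) :
    ∃ (e : Basis (Fin n) ℚ V) (a : Fin n → ℕ), (∀ i, e i ∈ L) ∧ (∀ i, 0 < a i) ∧
      ∀ i j, B (e i) (e j) = if i = j then (a i : ℚ) else 0 := by
  have : FiniteDimensional ℚ V := FiniteDimensional.of_finrank_pos (hrank ▸ hn)
  subst hrank
  obtain ⟨v, hv⟩ := LinearMap.BilinForm.exists_orthogonal_basis (B := B) ⟨fun x y ↦ hsymm x y⟩
  choose m hm hmL using fun i ↦
    exists_natCast_smul_mem_of_mem_span (L := L) (v := v i) (hspan ▸ Submodule.mem_top)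
  have hu (i) : IsUnit (m i : ℚ) := (Nat.cast_ne_zero.mpr (hm i)).isUnit
  let e := v.isUnitSMul hu
  have he (i) : e i = (m i : ℚ) • v i := Basis.isUnitSMul_apply hu i
  have heL (i) : e i ∈ L := he i ▸ hmL i
  have hex (i) : ∃ k : ℕ, 0 < k ∧ B (e i) (e i) = k := by
    obtain ⟨k, hk⟩ := hint _ (heL i) _ (heL i)
    have h := hpos _ (heL i) (e.ne_zero i)
    rw [hk, Int.cast_pos] at h
    lift k to ℕ using h.le
    exact ⟨k, by exact_mod_cast h, by exact_mod_cast hk⟩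
  choose a ha haB using hex
  refine ⟨e, a, heL, ha, fun i j ↦ ?_⟩
  split_ifs with hij
  · rw [← hij, haB]
  · have : B (v i) (v j) = 0 := hv hij
    rw [he, he, map_smul, map_smul, LinearMap.smul_apply, this, smul_zero, smul_zero]

/-- **Venkov's identity**: the roots of a Niemeier lattice form a spherical 2-design. -/
theorem sum_sq_roots_niemeier
    (hspan : Submodule.span ℚ (L : Set V) = ⊤) (hrank : finrank ℚ V = 24)
    (hsymm : ∀ x y : V, B x y = B y x) (hint : ∀ x ∈ L, ∀ y ∈ L, ∃ n : ℤ, B x y = (n : ℚ))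
    (hpos : ∀ x ∈ L, x ≠ 0 → 0 < B x x) (heven : ∀ x ∈ L, ∃ n : ℤ, B x x = 2 * (n : ℚ))
    (hunimod : ∀ v : V, (∀ y ∈ L, ∃ n : ℤ, B v y = (n : ℚ)) → v ∈ L) :
    ∃ R : Finset V, (∀ x, x ∈ R ↔ x ∈ L ∧ B x x = 2) ∧
      ∀ v, ∑ x ∈ R, B x v ^ 2 = R.card * B v v / 12 := by
  classical
  obtain ⟨e, a, heL, ha, hB⟩ :=
    exists_orthogonal_basis_mem_lattice (by norm_num) hspan hrank hsymm hint hpos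
  have ha' (i) : (a i : ℚ) ≠ 0 := Nat.cast_ne_zero.mpr (ha i).ne'
  have hBe (c : Fin 24 → ℚ) (j) : B (∑ i, c i • e i) (e j) = c j * a j := by
    simp [hB]
  have hBB (x : V) (c : Fin 24 → ℚ) : B x (∑ i, c i • e i) = ∑ i, B x (e i) * c i := by
    simp [mul_comm]
  have hrepr (x : V) : ∑ i, (B x (e i) / a i) • e i = x := by
    have h (i) : B x (e i) / a i = e.repr x i := by
      rw [div_eq_iff (ha' i), ← hBe, e.sum_repr]
    simp only [h, e.sum_repr]
  let ψ (k : Fin 24 → ℤ) : V := ∑ i, (k i / a i : ℚ) • e i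
  have hψe (k j) : B (ψ k) (e j) = k j := by rw [hBe, div_mul_cancel₀ _ (ha' j)]
  have hψ (k l) : diagPairing a k l = ((B (ψ k) (ψ l) : ℚ) : ℝ) := by
    have h : B (ψ k) (ψ l) = ∑ i, (k i : ℚ) * l i / a i := by
      rw [show ψ l = ∑ i, (l i / a i : ℚ) • e i from rfl, hBB]
      simp only [hψe, mul_div_assoc]
    rw [h, diagPairing]
    push_cast
    rfl
  have hsurj (x) (hx : x ∈ L) : ∃ k, ψ k = x := by
    choose k hk using fun i ↦ hint x hx (e i) (heL i)
    exact ⟨k, by simp only [ψ, ← hk, hrepr]⟩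
  have hinj : Function.Injective ψ := fun k l hkl ↦ by
    ext i
    have := hψe k i
    rw [hkl, hψe] at this
    exact_mod_cast this.symm
  have hΛ : IsDiagSelfDual a {k | ψ k ∈ L} := by
    refine ⟨ha, fun k ↦ ⟨fun hk l hl ↦ ?_, fun hk ↦ hunimod _ fun y hy ↦ ?_⟩⟩
    · obtain ⟨m, hm⟩ := hint _ hk _ hl
      exact ⟨m, by rw [hψ, hm, Rat.cast_intCast]⟩
    · obtain ⟨l, rfl⟩ := hsurj y hy
      obtain ⟨m, hm⟩ := hk l hy
      exact ⟨m, by rw [hψ] at hm; exact_mod_cast hm⟩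
  have hΛe : ∀ k ∈ {k | ψ k ∈ L}, ∃ m : ℤ, diagPairing a k k = 2 * m := fun k hk ↦ by
    obtain ⟨m, hm⟩ := heven _ hk
    exact ⟨m, by rw [hψ, hm]; push_cast; rfl⟩
  have hfin : {k | ψ k ∈ L ∧ diagPairing a k k = 2}.Finite :=
    (finite_setOf_diagPairing_self_eq ha 2).subset fun k hk ↦ hk.2
  have hiff (k) : diagPairing a k k = 2 ↔ B (ψ k) (ψ k) = 2 := by
    rw [hψ]
    norm_cast
  refine ⟨hfin.toFinset.image ψ, fun x ↦ ?_, fun v ↦ ?_⟩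
  · simp only [Finset.mem_image, Set.Finite.mem_toFinset, Set.mem_ofPred_eq, hiff]
    constructor
    · rintro ⟨k, hk, rfl⟩
      exact hk
    · rintro hx
      obtain ⟨k, rfl⟩ := hsurj x hx.1
      exact ⟨k, hx, rfl⟩
  · rw [Finset.sum_image hinj.injOn, Finset.card_image_of_injective _ hinj]
    have h := hΛ.sum_sq_of_pairing_self_eq_two hΛe (fun i ↦ ((B v (e i) / a i : ℚ) : ℂ))
      hfin.toFinset fun k ↦ by simp
    have h1 (x : V) : B x v = ∑ i, B x (e i) * (B v (e i) / a i) := by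
      rw [← hBB, hrepr]
    have h2 : B v v = ∑ i, a i * (B v (e i) / a i) ^ 2 := by
      rw [h1]
      refine Finset.sum_congr rfl fun i _ ↦ ?_
      have := ha' i
      field_simp
    rw [h2]
    simp only [h1 (ψ _), hψe]
    exact_mod_cast h

end Lattice

section Parity

variable {V : Type*} [AddCommGroup V] [Module ℚ V] {L : Submodule ℤ V}
  {B : V →ₗ[ℚ] V →ₗ[ℚ] ℚ} {R : Finset V}

theorem sum_roots_eq_two_mul_sum_pos (hR : ∀ x, x ∈ R ↔ x ∈ L ∧ B x x = 2)
    (f : V →ₗ[ℚ] ℚ) (hf : ∀ x ∈ R, f x ≠ 0) (g : V → ℚ) (hg : ∀ x, g (-x) = g x) :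
    ∑ x ∈ R, g x = 2 * ∑ x ∈ R with 0 < f x, g x := by
  have hneg : ∀ x ∈ R, -x ∈ R := fun x hx ↦ by simpa [hR] using hx
  have h : ∑ x ∈ R with ¬0 < f x, g x = ∑ x ∈ R with 0 < f x, g x := by
    refine Finset.sum_bij' (fun x _ ↦ -x) (fun x _ ↦ -x) ?_ ?_ ?_ ?_ ?_
    · intro x hx
      obtain ⟨hx, hfx⟩ := Finset.mem_filter.mp hx
      refine Finset.mem_filter.mpr ⟨hneg x hx, ?_⟩
      rw [map_neg, neg_pos]
      exact lt_of_le_of_ne (not_lt.mp hfx) (hf x hx)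
    · intro x hx
      obtain ⟨hx, hfx⟩ := Finset.mem_filter.mp hx
      refine Finset.mem_filter.mpr ⟨hneg x hx, ?_⟩
      rw [map_neg, neg_pos]
      exact hfx.not_gt
    · exact fun x _ ↦ neg_neg x
    · exact fun x _ ↦ neg_neg x
    · exact fun x _ ↦ (hg x).symm
  rw [← Finset.sum_filter_add_sum_filter_not R (fun x ↦ 0 < f x), h, two_mul]

theorem even_card_roots_pairing_eq_one (hsymm : ∀ x y : V, B x y = B y x)
    (hR : ∀ x, x ∈ R ↔ x ∈ L ∧ B x x = 2) {s : V} (hs : s ∈ R) :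
    Even (R.filter fun x ↦ B x s = 1).card := by
  obtain ⟨hsL, hss⟩ := (hR s).mp hs
  have h : ∑ x ∈ R with B x s = 1, (1 : ZMod 2) = 0 := by
    refine Finset.sum_involution (fun x _ ↦ s - x) (fun _ _ ↦ by decide) (fun x hx _ h ↦ ?_)
      (fun x hx ↦ ?_) fun x _ ↦ sub_sub_cancel s x
    · obtain ⟨hxR, hxs⟩ := Finset.mem_filter.mp hx
      rw [← sub_add_cancel s x, h, map_add, ((hR x).mp hxR).2] at hxs
      norm_num at hxs
    · obtain ⟨hxR, hxs⟩ := Finset.mem_filter.mp hx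
      obtain ⟨hxL, hxx⟩ := (hR x).mp hxR
      refine Finset.mem_filter.mpr ⟨(hR _).mpr ⟨L.sub_mem hsL hxL, ?_⟩, ?_⟩
      · simp only [map_sub, LinearMap.sub_apply, hss, hxx, hsymm s x, hxs]
        norm_num
      · rw [map_sub, LinearMap.sub_apply, hss, hxs]
        norm_num
  rwa [Finset.sum_const, nsmul_one, ZMod.natCast_eq_zero_iff_even] at h

theorem sq_pairing_root (hsymm : ∀ x y : V, B x y = B y x)
    (hint : ∀ x ∈ L, ∀ y ∈ L, ∃ n : ℤ, B x y = (n : ℚ)) (hpos : ∀ x ∈ L, x ≠ 0 → 0 < B x x)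
    [DecidableEq V] {x s : V} (hx : x ∈ L ∧ B x x = 2) (hs : s ∈ L ∧ B s s = 2) :
    B x s ^ 2 = (if x = s then 4 else 0) + (if x = -s then 4 else 0) +
      ((if B x s = 1 then 1 else 0) + if B x s = -1 then 1 else 0) := by
  by_cases h1 : x = s
  · subst h1
    have h0 : x ≠ -x := fun h ↦ by
      have h2 : B x x = B x (-x) := congrArg (B x) h
      rw [map_neg, hx.2] at h2
      norm_num at h2
    rw [hx.2, if_pos rfl, if_neg h0]
    norm_num
  by_cases h2 : x = -s
  · subst h2
    rw [map_neg, LinearMap.neg_apply, hs.2, if_neg h1, if_pos rfl]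
    norm_num
  obtain ⟨n, hn⟩ := hint x hx.1 s hs.1
  have h3 := hpos (x - s) (L.sub_mem hx.1 hs.1) (sub_ne_zero.mpr h1)
  have h4 := hpos (x + s) (L.add_mem hx.1 hs.1) (fun h ↦ h2 (eq_neg_of_add_eq_zero_left h))
  simp only [map_sub, map_add, LinearMap.sub_apply, LinearMap.add_apply, hx.2, hs.2,
    hsymm s x, hn] at h3 h4
  have h5 : n < 2 := by exact_mod_cast (by linarith : (n : ℚ) < 2)
  have h6 : -2 < n := by exact_mod_cast (by linarith : (-2 : ℚ) < n)
  rw [if_neg h1, if_neg h2, hn]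
  interval_cases n <;> norm_num

theorem dvd_card_roots (hsymm : ∀ x y : V, B x y = B y x)
    (hint : ∀ x ∈ L, ∀ y ∈ L, ∃ n : ℤ, B x y = (n : ℚ)) (hpos : ∀ x ∈ L, x ≠ 0 → 0 < B x x)
    (hR : ∀ x, x ∈ R ↔ x ∈ L ∧ B x x = 2)
    (hdesign : ∀ v, ∑ x ∈ R, B x v ^ 2 = R.card * B v v / 12) : 24 ∣ R.card := by
  classical
  obtain rfl | ⟨s, hs⟩ := R.eq_empty_or_nonempty
  · simp
  have hs' := (hR s).mp hs
  have hns : -s ∈ R := by simpa [hR] using hs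
  have hneg : (R.filter fun x ↦ B x s = -1).card = (R.filter fun x ↦ B x s = 1).card := by
    refine Finset.card_bij' (fun x _ ↦ -x) (fun x _ ↦ -x) ?_ ?_ ?_ ?_ <;>
      simp +contextual [hR]
  obtain ⟨c, hc⟩ := even_card_roots_pairing_eq_one hsymm hR hs
  have h := hdesign s
  rw [Finset.sum_congr rfl fun x hx ↦ sq_pairing_root hsymm hint hpos ((hR x).mp hx) hs',
    Finset.sum_add_distrib, Finset.sum_add_distrib, Finset.sum_add_distrib,
    Finset.sum_ite_eq', Finset.sum_ite_eq', if_pos hs, if_pos hns, Finset.sum_boole,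
    Finset.sum_boole, hneg, hc, hs'.2] at h
  refine ⟨2 + c, ?_⟩
  have : (R.card : ℚ) = 24 * (2 + c) := by
    push_cast at h
    linarith
  exact_mod_cast this

end Parity

/-- The Weyl vector of a Niemeier lattice `N` (half the sum of the positive roots, a priori
an element of `N ⊗ ℚ`) lies in `N`; equivalently the sum of the positive roots lies in `2N`. -/
theorem niemeier_weyl_vector_mem
    (V : Type*) [AddCommGroup V] [Module ℚ V]
    (L : Submodule ℤ V) (hfg : L.FG)
    (hspan : Submodule.span ℚ (L : Set V) = ⊤)
    (hrank : Module.finrank ℚ V = 24)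
    (B : V →ₗ[ℚ] V →ₗ[ℚ] ℚ)
    (hsymm : ∀ x y : V, B x y = B y x)
    (hint : ∀ x ∈ L, ∀ y ∈ L, ∃ n : ℤ, B x y = (n : ℚ))
    (hpos : ∀ x ∈ L, x ≠ 0 → 0 < B x x)
    (heven : ∀ x ∈ L, ∃ n : ℤ, B x x = 2 * (n : ℚ))
    (hunimod : ∀ v : V, (∀ y ∈ L, ∃ n : ℤ, B v y = (n : ℚ)) → v ∈ L)
    (f : V →ₗ[ℚ] ℚ)
    (hf : ∀ x ∈ L, B x x = 2 → f x ≠ 0)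
    (ρ : V)
    (hρ : ρ = (2⁻¹ : ℚ) • ∑ᶠ x ∈ {x : V | x ∈ L ∧ B x x = 2 ∧ 0 < f x}, x) :
    ρ ∈ L := by
  obtain ⟨R, hR, hdesign⟩ := sum_sq_roots_niemeier hspan hrank hsymm hint hpos heven hunimod
  obtain ⟨t, ht⟩ := dvd_card_roots hsymm hint hpos hR hdesign
  have hset : {x : V | x ∈ L ∧ B x x = 2 ∧ 0 < f x} = ↑(R.filter fun x ↦ 0 < f x) := by
    ext x
    simp [hR, and_assoc]
  rw [hset, finsum_mem_coe_finset] at hρ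
  refine hunimod ρ fun y hy ↦ ?_
  have hn (x) (hx : x ∈ L) : ∃ n : ℤ, B x y = n := hint x hx y hy
  choose! n hn using hn
  have hnP : ∀ x ∈ R.filter (fun x ↦ 0 < f x), B x y = n x := fun x hx ↦
    hn x ((hR x).mp (Finset.mem_filter.mp hx).1).1
  obtain ⟨m, hm⟩ := heven y hy
  have hsq : ∑ x ∈ R with 0 < f x, n x ^ 2 = 2 * (t * m) := by
    have h := sum_roots_eq_two_mul_sum_pos hR f (fun x hx ↦ hf x ((hR x).mp hx).1 ((hR x).mp hx).2)
      (fun x ↦ B x y ^ 2) (fun x ↦ by simp)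
    rw [hdesign, hm, ht, Finset.sum_congr rfl fun x hx ↦ congrArg (· ^ 2) (hnP x hx)] at h
    have h2 : ((∑ x ∈ R with 0 < f x, n x ^ 2 : ℤ) : ℚ) = 2 * (t * m) := by
      push_cast at h ⊢
      linarith
    exact_mod_cast h2
  have heven_sub : Even (∑ x ∈ R with 0 < f x, (n x ^ 2 - n x)) :=
    Finset.even_sum _ fun x _ ↦ by
      rw [sq, ← mul_sub_one]
      exact Int.even_mul_pred_self _
  rw [Finset.sum_sub_distrib, hsq] at heven_sub
  obtain ⟨k, hk⟩ := heven_sub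
  refine ⟨t * m - k, ?_⟩
  have hk' : ∑ x ∈ R with 0 < f x, n x = 2 * (t * m - k) := by linarith
  rw [hρ, map_smul, map_sum, LinearMap.smul_apply, LinearMap.sum_apply,
    Finset.sum_congr rfl hnP, ← Int.cast_sum, hk', smul_eq_mul]
  push_cast
  ring
end
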